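/- Assume that for each r and each (m−3−r)-element subset W of {1,…,m−3}, every point of 𝕃_s ∩ ℛ^∘_{(L_m)_{I_r(W)}} has intersection multiplicity r! in 𝕃_s ∩ ℛ_{L_m}. Then for generic Mandelstam invariants s, the set 𝕃_s ∩ ℛ_{L_m} is finite and decomposes as the disjoint union over r = 0,…,m−4 and W ∈ C({1,…,m−3}, m−3−r) of the sets 𝕃_s ∩ ℛ^∘_{(L_m)_{I_r(W)}}; the component indexed by (r,W) consists of (m−3−r)! points, each of multiplicity r!, and the nonzero coordinates of these points are the solutions of the CHY scattering equations for the particles indexed by 1, 2, m and W. -/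

import Mathlib

open scoped BigOperators
noncomputable section

namespace ScatteringPaper

open CategoryTheory AlgebraicTopology

/- ## Topological Euler characteristic via rational singular homology -/

/-- The singular chain complex of a topological space, with rational coefficients. -/
def singularChainComplex (X : Type) [TopologicalSpace X] : ChainComplex (ModuleCat ℚ) ℕ :=
  (alternatingFaceMapComplex (ModuleCat ℚ)).obj
    (((SimplicialObject.whiskering _ _).obj (ModuleCat.free ℚ)).obj (TopCat.toSSet.obj (TopCat.of X)))

/-- The `q`-th (rational) Betti number of a topological space. -/
def betti (X : Type) [TopologicalSpace X] (q : ℕ) : ℕ :=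
  Module.finrank ℚ ((singularChainComplex X).homology q)

/-- The topological Euler characteristic, as the alternating sum of Betti numbers. -/
def eulerChar (X : Type) [TopologicalSpace X] : ℤ :=
  ∑ᶠ q : ℕ, (-1 : ℤ) ^ q * (betti X q : ℤ)

variable {d : ℕ} {ι : Type} [Fintype ι] [DecidableEq ι]

/- ## Hyperplane arrangements: `(ℓ_i(x))_i = (1, x_1, …, x_d) · L` -/

/-- Value of the affine-linear form encoded by column `i` of `L`. -/
def ell (K : Type) [Field K] (L : Matrix (Fin (d+1)) ι K) (x : Fin d → K) (i : ι) : K :=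
  L 0 i + ∑ j : Fin d, x j * L j.succ i

/-- The complement `X = ℂ^d ∖ 𝒜` of the arrangement `𝒜 = V(∏ ℓ_i)`. -/
def complementX (L : Matrix (Fin (d+1)) ι ℂ) : Set (Fin d → ℂ) := {x | ∀ i, ell ℂ L x i ≠ 0}

/-- `x ∈ X` is a solution of the scattering equations
`∂ℒ_u/∂x_k = ∑_i u_i a_{ki}/ℓ_i(x) = 0`, `k = 1, …, d`. -/
def IsSol (L : Matrix (Fin (d+1)) ι ℂ) (u : ι → ℂ) (x : Fin d → ℂ) : Prop :=
  x ∈ complementX L ∧ ∀ k : Fin d, ∑ i : ι, u i * L k.succ i / ell ℂ L x i = 0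

/-- An arrangement is essential if some subset of its hyperplanes meets in a single point. -/
def IsEssential (L : Matrix (Fin (d+1)) ι ℂ) : Prop :=
  ∃ (S : Set ι) (x₀ : Fin d → ℂ), {x : Fin d → ℂ | ∀ i ∈ S, ell ℂ L x i = 0} = {x₀}

/-- `P u` holds for all `u` outside a proper algebraic subset (i.e. for generic `u`). -/
def Generically {σ : Type} [Fintype σ] [DecidableEq σ] (P : (σ → ℂ) → Prop) : Prop :=
  ∃ g : MvPolynomial σ ℂ, g ≠ 0 ∧ ∀ u : σ → ℂ, MvPolynomial.eval u g ≠ 0 → P u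

/- ## Matroid data of the columns of `L` -/

/-- Rank of the set `I` of columns of `L` (the matroid rank in `M(L)`). -/
def rkL (K : Type) [Field K] (L : Matrix (Fin (d+1)) ι K) (I : Set ι) : ℕ :=
  Module.finrank K (Submodule.span K ((fun i => fun r => L r i) '' I))

/-- Rank of the set `I` of columns of `A^⊤` (`L` with its first row deleted). -/
def rkA (K : Type) [Field K] (L : Matrix (Fin (d+1)) ι K) (I : Set ι) : ℕ :=
  Module.finrank K (Submodule.span K ((fun i => fun k : Fin d => L k.succ i) '' I))

/-- `I` is a flat of the matroid `M(L)`. -/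
def IsFlat (K : Type) [Field K] (L : Matrix (Fin (d+1)) ι K) (I : Set ι) : Prop :=
  ∀ i ∉ I, rkL K L I < rkL K L (insert i I)

/-- `C` is a circuit of `M(L)`: a minimal linearly dependent set of columns. -/
def IsCircuit (K : Type) [Field K] (L : Matrix (Fin (d+1)) ι K) (C : Finset ι) : Prop :=
  (¬ LinearIndependent K (fun i : {a // a ∈ C} => fun r => L r i.1)) ∧
  ∀ D : Finset ι, D ⊂ C → LinearIndependent K (fun i : {a // a ∈ D} => fun r => L r i.1)

/-- `M(L)` is connected: there is no separation into two nonempty parts with additive rank. -/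
def MatroidConnected (K : Type) [Field K] (L : Matrix (Fin (d+1)) ι K) : Prop :=
  ∀ S : Set ι, S.Nonempty → Sᶜ.Nonempty → rkL K L S + rkL K L Sᶜ ≠ rkL K L Set.univ

/- ## The reciprocal linear space -/

/-- Zariski closure of a subset of affine space `K^ι`. -/
def zarClosure (K : Type) [Field K] (S : Set (ι → K)) : Set (ι → K) :=
  {v | ∀ f : MvPolynomial ι K, (∀ w ∈ S, MvPolynomial.eval w f = 0) → MvPolynomial.eval v f = 0}

/-- The affine cone over the image of `φ : x ↦ (ℓ_0(x)⁻¹ : ⋯ : ℓ_n(x)⁻¹)`. -/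
def coneImage (L : Matrix (Fin (d+1)) ι ℂ) : Set (ι → ℂ) :=
  {v | ∃ (c : ℂ) (x : Fin d → ℂ), x ∈ complementX L ∧ v = fun i => c / ell ℂ L x i}

/-- The vanishing ideal of a subset of affine space. -/
def vanishingIdeal (K : Type) [Field K] (S : Set (ι → K)) : Ideal (MvPolynomial ι K) where
  carrier := {f | ∀ v ∈ S, MvPolynomial.eval v f = 0}
  add_mem' := by
    intro a b ha hb v hv
    simp [map_add, ha v hv, hb v hv]
  zero_mem' := by intro v hv; simp
  smul_mem' := by
    intro c f hf v hv
    simp [smul_eq_mul, map_mul, hf v hv]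

/-- Projective space `ℙ^n = ℙ(ℂ^ι)`. -/
abbrev Pn (ι : Type) [Fintype ι] := Projectivization ℂ (ι → ℂ)

/-- The reciprocal linear space `ℛ_L ⊂ ℙ^n`, the Zariski closure of `im φ`. -/
def RL (L : Matrix (Fin (d+1)) ι ℂ) : Set (Pn ι) :=
  {p | p.rep ∈ zarClosure ℂ (coneImage L)}

/-- The linear space `𝕃_u = {y : A^⊤ diag(u) y = 0} ⊂ ℙ^n`. -/
def LuSet (L : Matrix (Fin (d+1)) ι ℂ) (u : ι → ℂ) : Set (Pn ι) :=
  {p | ∀ k : Fin d, ∑ i : ι, L k.succ i * u i * p.rep i = 0}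

/-- The torus orbit `U_I = {y ∈ ℙ^n : y_i ≠ 0 ⇔ i ∈ I}`. -/
def Ustratum (I : Set ι) : Set (Pn ι) := {p : Pn ι | ∀ i : ι, p.rep i ≠ 0 ↔ i ∈ I}

/-- `p = φ(x)` for the map `φ : x ↦ (ℓ_0(x)⁻¹ : ⋯ : ℓ_n(x)⁻¹)`. -/
def PhiRel (L : Matrix (Fin (d+1)) ι ℂ) (x : Fin d → ℂ) (p : Pn ι) : Prop :=
  ∃ hv : (fun i => (ell ℂ L x i)⁻¹) ≠ 0, p = Projectivization.mk ℂ (fun i => (ell ℂ L x i)⁻¹) hv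

/-- The image of `φ` in `ℙ^n`. -/
def imPhi (L : Matrix (Fin (d+1)) ι ℂ) : Set (Pn ι) :=
  {p | ∃ x ∈ complementX L, PhiRel L x p}

/-- Complement of the subarrangement `𝒜_I`. -/
def subComplement (L : Matrix (Fin (d+1)) ι ℂ) (I : Set ι) : Set (Fin d → ℂ) :=
  {x | ∀ i ∈ I, ell ℂ L x i ≠ 0}

/-- The affine cone over the image of the reciprocal map of the subarrangement indexed by `I`,
embedded in the coordinate subspace `{y_i = 0, i ∉ I}`. -/
def coneImageSub (L : Matrix (Fin (d+1)) ι ℂ) (I : Set ι) : Set (ι → ℂ) :=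
  {v | ∃ (c : ℂ) (x : Fin d → ℂ), x ∈ subComplement L I ∧
      v = I.indicator (fun i => c / ell ℂ L x i)}

/-- The reciprocal linear space `ℛ_{L_I}` of the submatrix `L_I`, embedded in `ℙ^n`. -/
def RLsub (L : Matrix (Fin (d+1)) ι ℂ) (I : Set ι) : Set (Pn ι) :=
  {p | p.rep ∈ zarClosure ℂ (coneImageSub L I)}

/-- The open stratum `ℛ_{L_I}^∘ = ℛ_{L_I} ∩ U_I`. -/
def RLsubOpen (L : Matrix (Fin (d+1)) ι ℂ) (I : Set ι) : Set (Pn ι) :=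
  RLsub L I ∩ Ustratum I

/- ## The very affine variety `X_I = (ℂ^d ∖ 𝒜_I)/K_I` -/

/-- Quotient of `ℂ^d ∖ 𝒜_I` by translation by the left kernel `K_I` of `A_I^⊤`:
two points are identified iff `A_I^⊤` takes the same values on them. -/
def XIsetoid (L : Matrix (Fin (d+1)) ι ℂ) (I : Set ι) : Setoid ↥(subComplement L I) where
  r x y := ∀ i ∈ I, ∑ k : Fin d, (x : Fin d → ℂ) k * L k.succ i
      = ∑ k : Fin d, (y : Fin d → ℂ) k * L k.succ i
  iseqv := ⟨fun _ _ _ => rfl, fun h i hi => (h i hi).symm, fun h1 h2 i hi => (h1 i hi).trans (h2 i hi)⟩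

/-- The very affine variety `X_I = (ℂ^d ∖ 𝒜_I)/K_I`. -/
def XI (L : Matrix (Fin (d+1)) ι ℂ) (I : Set ι) : Type := Quotient (XIsetoid L I)

instance (L : Matrix (Fin (d+1)) ι ℂ) (I : Set ι) : TopologicalSpace (XI L I) :=
  instTopologicalSpaceQuotient

/-- The complement of the arrangement, over a general field `K`. -/
def complementK (K : Type) [Field K] (L : Matrix (Fin (d+1)) ι K) : Set (Fin d → K) :=
  {x | ∀ i, ell K L x i ≠ 0}

/-- The affine cone over the image of the reciprocal map, over a general field `K`. -/
def coneImageK (K : Type) [Field K] (L : Matrix (Fin (d+1)) ι K) : Set (ι → K) :=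
  {v | ∃ (c : K) (x : Fin d → K), x ∈ complementK K L ∧ v = fun i => c / ell K L x i}

/- ## Hilbert functions, degree, Hilbert regularity -/

/-- The Hilbert function of the graded algebra `K[y]/I`:
`q ↦ dim_K (K[y]/I)_q`. -/
def hilb (K : Type) [Field K] (I : Ideal (MvPolynomial ι K)) (q : ℕ) : ℕ :=
  Module.finrank K ((MvPolynomial.homogeneousSubmodule ι K q).map
    (Ideal.Quotient.mkₐ K I).toLinearMap)

/-- `k` is the degree of the `d`-dimensional projective variety with homogeneous
coordinate ring `K[y]/I`: the Hilbert polynomial has degree `d` and leading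
coefficient `k/d!`. -/
def IsProjDegree (K : Type) [Field K] (I : Ideal (MvPolynomial ι K)) (d k : ℕ) : Prop :=
  ∃ P : Polynomial ℚ, (∃ N : ℕ, ∀ q : ℕ, N ≤ q → Polynomial.eval (q : ℚ) P = hilb K I q) ∧
    P.degree = (d : WithBot ℕ) ∧ P.leadingCoeff = (k : ℚ) / (Nat.factorial d : ℚ)

/-- The Hilbert function, extended by `0` to negative integers. -/
def HFZ (K : Type) [Field K] (I : Ideal (MvPolynomial ι K)) (q : ℤ) : ℕ :=
  if 0 ≤ q then hilb K I q.toNat else 0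

/-- The Hilbert regularity: the smallest degree from which the Hilbert function
agrees with a (necessarily unique) polynomial. -/
def HReg (K : Type) [Field K] (I : Ideal (MvPolynomial ι K)) : ℤ :=
  sInf {i : ℤ | ∃ P : Polynomial ℚ, ∀ q : ℤ, i ≤ q → Polynomial.eval (q : ℚ) P = HFZ K I q}

/-- Column indices of the matrix `L_m`: pairs `0 ≤ a < b ≤ m-2` of labels of the `m-1` finite
points `z_0 = 0, z_1 = 1, z_{k+1} = x_k (k = 1, …, m-3)` on the line, except the pair `(0,1)`
(whose minor `p_{12}` is constant).  The column `(a,b)` encodes the linear form `z_b − z_a`. -/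
def ColIdx (m : ℕ) : Type :=
  {p : Fin (m-1) × Fin (m-1) // p.1 < p.2 ∧ ¬((p.1 : ℕ) = 0 ∧ (p.2 : ℕ) = 1)}

instance (m : ℕ) : Fintype (ColIdx m) := by unfold ColIdx; infer_instance
instance (m : ℕ) : DecidableEq (ColIdx m) := by unfold ColIdx; infer_instance

/-- Coefficient vector of the point `z_t` in the coordinates `(1, x_1, …, x_{m-3})`. -/
def zCoeff (m : ℕ) (t : Fin (m-1)) : Fin (m-3+1) → ℂ :=
  fun r => if (t : ℕ) = (r : ℕ) + 1 then 1 else 0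

/-- The `(m-2) × (m(m-3)/2)` coefficient matrix `L_m` of the hyperplane arrangement model of
`𝓜_{0,m}`: column `(a,b)` is the coefficient vector of `z_b − z_a`. -/
def Lm (m : ℕ) : Matrix (Fin (m-3+1)) (ColIdx m) ℂ :=
  Matrix.of fun r c => zCoeff m c.1.2 r - zCoeff m c.1.1 r
/-- The flat `I_r(W) = {x_i : i ∈ W} ∪ {x_j − x_i : j ∈ W, i ∈ {0} ∪ W, i < j}` (with
`x_0 = 1`), as a set of columns of `L_m`. -/
def Iflat (m : ℕ) (W : Finset ℕ) : Set (ColIdx m) :=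
  {c | (∃ i ∈ W, (c.1.2 : ℕ) = i + 1) ∧
       ((c.1.1 : ℕ) = 0 ∨ (c.1.1 : ℕ) = 1 ∨ ∃ i ∈ W, (c.1.1 : ℕ) = i + 1)}

/-- The homogeneous vanishing ideal of the cone over a point `p ∈ ℙ^n`. -/
def ptIdeal {ι : Type} [Fintype ι] [DecidableEq ι] (p : Pn ι) : Ideal (MvPolynomial ι ℂ) :=
  vanishingIdeal ℂ {v : ι → ℂ | ∃ c : ℂ, v = c • p.rep}

/-- The ideal `{f : s·f ∈ J}`. -/
def divIdeal {R : Type} [CommRing R] (J : Ideal R) (s : R) : Ideal R where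
  carrier := {f | s * f ∈ J}
  zero_mem' := by simp
  add_mem' := by
    intro a b ha hb
    simpa [mul_add] using J.add_mem ha hb
  smul_mem' := by
    intro c f hf
    have h : s * (c * f) = c * (s * f) := by ring
    simpa [smul_eq_mul, h] using J.mul_mem_left c hf

/-- The `p`-primary part of `J`: the contraction of the localization of `J` away from the
prime of `p` (all elements killed into `J` by something not vanishing at `p`). -/
def localPart {ι : Type} [Fintype ι] [DecidableEq ι] (J : Ideal (MvPolynomial ι ℂ))
    (p : Pn ι) : Ideal (MvPolynomial ι ℂ) :=
  sSup {K | ∃ s, s ∉ ptIdeal p ∧ K = divIdeal J s}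

/-- The intersection multiplicity of the zero-dimensional projective scheme `V(J)` at `p`:
the degree (eventual Hilbert function value) of its `p`-primary component. -/
def multAt {ι : Type} [Fintype ι] [DecidableEq ι] (J : Ideal (MvPolynomial ι ℂ))
    (p : Pn ι) : ℕ :=
  sInf {k : ℕ | ∀ᶠ q in Filter.atTop, hilb ℂ (localPart J p) q = k}

/-- The homogeneous ideal of the scheme `𝕃_s ∩ ℛ_{L_m}`: the ideal of `ℛ_{L_m}` plus the
linear forms `A_m^⊤ diag(s) y`. -/
def schemeIdeal (m : ℕ) (s : ColIdx m → ℂ) : Ideal (MvPolynomial (ColIdx m) ℂ) :=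
  vanishingIdeal ℂ (coneImage (Lm m)) ⊔
    Ideal.span {g | ∃ k : Fin (m-3), g = ∑ i : ColIdx m,
      MvPolynomial.C (Lm m k.succ i * s i) * MvPolynomial.X i}


/-- Chevalley-type dichotomy for projections of algebraic sets. -/
theorem proj_dichotomy {σ τ : Type} [Fintype σ] [Fintype τ]
    (F : Set (MvPolynomial (σ ⊕ τ) ℂ)) :
    (∃ h : MvPolynomial σ ℂ, h ≠ 0 ∧ ∀ s : σ → ℂ, MvPolynomial.eval s h ≠ 0 →
      ∃ y : τ → ℂ, ∀ f ∈ F, MvPolynomial.eval (Sum.elim s y) f = 0) ∨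
    (∃ h : MvPolynomial σ ℂ, h ≠ 0 ∧ ∀ s : σ → ℂ, MvPolynomial.eval s h ≠ 0 →
      ¬ ∃ y : τ → ℂ, ∀ f ∈ F, MvPolynomial.eval (Sum.elim s y) f = 0) := by
  classical
  set J : Ideal (MvPolynomial (σ ⊕ τ) ℂ) := Ideal.span F with hJ
  set ρ : MvPolynomial σ ℂ →ₐ[ℂ] MvPolynomial (σ ⊕ τ) ℂ := MvPolynomial.rename Sum.inl with hρ
  set φ : MvPolynomial σ ℂ →ₐ[ℂ] (MvPolynomial (σ ⊕ τ) ℂ ⧸ J) :=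
    (Ideal.Quotient.mkₐ ℂ J).comp ρ with hφ
  by_cases hinj : Function.Injective φ.toRingHom
  · left
    have hfp : φ.toRingHom.FinitePresentation := by
      apply RingHom.FinitePresentation.of_finiteType.mp
      have : (φ : MvPolynomial σ ℂ →ₐ[ℂ] _).FiniteType := by
        apply AlgHom.FiniteType.of_comp_finiteType (f := Algebra.ofId ℂ (MvPolynomial σ ℂ))
        have h2 : Algebra.FiniteType ℂ (MvPolynomial (σ ⊕ τ) ℂ ⧸ J) := inferInstance
        have h3 : φ.comp (Algebra.ofId ℂ (MvPolynomial σ ℂ)) = Algebra.ofId ℂ _ :=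
          Subsingleton.elim _ _
        rw [h3]
        show RingHom.FiniteType _
        exact RingHom.finiteType_algebraMap.mpr h2
      exact this
    have hcon := PrimeSpectrum.isConstructible_range_comap hfp
    obtain ⟨S, hS⟩ := PrimeSpectrum.exists_constructibleSetData_iff.mpr hcon
    have hbot : (⊥ : PrimeSpectrum (MvPolynomial σ ℂ)) ∈ S.toSet := by
      rw [hS]
      obtain ⟨p, hp, hp2⟩ := Ideal.exists_comap_eq_of_mem_minimalPrimes_of_injective hinj
        (⊥ : Ideal (MvPolynomial σ ℂ)) (by simp [IsDomain.minimalPrimes_eq_singleton_bot])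
      exact ⟨⟨p, hp⟩, PrimeSpectrum.ext hp2⟩
    simp only [PrimeSpectrum.ConstructibleSetData.toSet, Set.mem_iUnion] at hbot
    obtain ⟨C, hC, hCm⟩ := hbot
    obtain ⟨hg, hf⟩ := hCm
    have hf0 : C.f ≠ 0 := by
      intro h
      apply hf
      simp [h]
    have hg0 : ∀ i, C.g i = 0 := by
      intro i
      have := hg (Set.mem_range_self i)
      simpa using this
    refine ⟨C.f, hf0, fun s hs => ?_⟩
    set P : Ideal (MvPolynomial σ ℂ) := MvPolynomial.vanishingIdeal ℂ {s} with hP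
    have hPmax : P.IsMaximal := MvPolynomial.isMaximal_iff_eq_vanishingIdeal_singleton.mpr ⟨s, rfl⟩
    have hPmem : (⟨P, hPmax.isPrime⟩ : PrimeSpectrum (MvPolynomial σ ℂ)) ∈ S.toSet := by
      simp only [PrimeSpectrum.ConstructibleSetData.toSet, Set.mem_iUnion]
      refine ⟨C, hC, ?_, ?_⟩
      · rintro _ ⟨i, rfl⟩
        simp [hg0 i]
      · intro h
        have h1 : C.f ∈ P := h rfl
        rw [hP, MvPolynomial.mem_vanishingIdeal_singleton_iff] at h1
        apply hs
        rwa [MvPolynomial.aeval_eq_eval] at h1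
    rw [hS] at hPmem
    obtain ⟨q, hq⟩ := hPmem
    obtain ⟨n, hn, hqn⟩ := Ideal.exists_le_maximal q.asIdeal q.isPrime.ne_top
    have hn' : (n.comap (Ideal.Quotient.mk J)).IsMaximal :=
      Ideal.comap_isMaximal_of_surjective _ Ideal.Quotient.mk_surjective
    obtain ⟨z, hz⟩ := MvPolynomial.isMaximal_iff_eq_vanishingIdeal_singleton.mp hn'
    have hzmem : ∀ f, Ideal.Quotient.mk J f ∈ n → MvPolynomial.eval z f = 0 := by
      intro f hf
      have h1 : f ∈ n.comap (Ideal.Quotient.mk J) := hf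
      rw [hz, MvPolynomial.mem_vanishingIdeal_singleton_iff] at h1
      rwa [MvPolynomial.aeval_eq_eval] at h1
    have hzs : ∀ i, z (Sum.inl i) = s i := by
      intro i
      have h1 : (MvPolynomial.X i - MvPolynomial.C (s i) : MvPolynomial σ ℂ) ∈ P := by
        rw [hP, MvPolynomial.mem_vanishingIdeal_singleton_iff]
        simp
      have h2 : P = q.asIdeal.comap φ.toRingHom := by
        have := congrArg PrimeSpectrum.asIdeal hq
        exact this.symm
      rw [h2] at h1
      have h3 := hqn h1
      have h4 := hzmem (ρ (MvPolynomial.X i - MvPolynomial.C (s i))) h3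
      simp [hρ] at h4
      exact sub_eq_zero.mp h4
    refine ⟨fun t => z (Sum.inr t), fun f hf => ?_⟩
    have h1 : Sum.elim s (fun t => z (Sum.inr t)) = z := by
      ext (i | t)
      · simp [hzs]
      · simp
    rw [h1]
    apply hzmem
    have : Ideal.Quotient.mk J f = 0 := Ideal.Quotient.eq_zero_iff_mem.mpr (Ideal.subset_span hf)
    rw [this]
    exact n.zero_mem
  · right
    rw [injective_iff_map_eq_zero] at hinj
    push Not at hinj
    obtain ⟨h, hh, hne⟩ := hinj
    refine ⟨h, hne, ?_⟩
    rintro s hs ⟨y, hy⟩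
    apply hs
    have h1 : ρ h ∈ J := Ideal.Quotient.eq_zero_iff_mem.mp hh
    have h2 : J ≤ RingHom.ker (MvPolynomial.eval (Sum.elim s y)) := by
      rw [hJ, Ideal.span_le]
      intro f hf
      exact hy f hf
    have h3 := h2 h1
    rw [RingHom.mem_ker, hρ] at h3
    rw [MvPolynomial.eval_rename] at h3
    simpa using h3



/-- The set of `s` such that the system `F(s, ·)` has at least `k` distinct solutions is
generically everything or generically empty. -/
theorem family_dichotomy {σ κ : Type} [Fintype σ] [Fintype κ]
    (F : Set (MvPolynomial (σ ⊕ κ) ℂ)) (k : ℕ) :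
    (∃ h : MvPolynomial σ ℂ, h ≠ 0 ∧ ∀ s : σ → ℂ, MvPolynomial.eval s h ≠ 0 →
      ∃ x : Fin k → κ → ℂ, Function.Injective x ∧
        ∀ i, ∀ f ∈ F, MvPolynomial.eval (Sum.elim s (x i)) f = 0) ∨
    (∃ h : MvPolynomial σ ℂ, h ≠ 0 ∧ ∀ s : σ → ℂ, MvPolynomial.eval s h ≠ 0 →
      ¬ ∃ x : Fin k → κ → ℂ, Function.Injective x ∧
        ∀ i, ∀ f ∈ F, MvPolynomial.eval (Sum.elim s (x i)) f = 0) := by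
  classical
  let τ := (Fin k × κ) ⊕ (Fin k × Fin k × κ)
  let ρ : Fin k → σ ⊕ κ → σ ⊕ τ := fun i => Sum.map id (fun c => Sum.inl (i, c))
  let D : Fin k → Fin k → MvPolynomial (σ ⊕ τ) ℂ := fun i j =>
    ∑ c : κ, MvPolynomial.X (Sum.inr (Sum.inr (i, j, c))) *
      (MvPolynomial.X (Sum.inr (Sum.inl (i, c))) - MvPolynomial.X (Sum.inr (Sum.inl (j, c)))) - 1
  let F' : Set (MvPolynomial (σ ⊕ τ) ℂ) :=
    {f | (∃ i, ∃ f0 ∈ F, f = MvPolynomial.rename (ρ i) f0) ∨ (∃ i j, i ≠ j ∧ f = D i j)}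
  have key : ∀ s : σ → ℂ, (∃ y : τ → ℂ, ∀ f ∈ F', MvPolynomial.eval (Sum.elim s y) f = 0) ↔
      ∃ x : Fin k → κ → ℂ, Function.Injective x ∧
        ∀ i, ∀ f ∈ F, MvPolynomial.eval (Sum.elim s (x i)) f = 0 := by
    intro s
    have hcomp : ∀ (y : τ → ℂ) (i : Fin k),
        (Sum.elim s y) ∘ ρ i = Sum.elim s (fun c => y (Sum.inl (i, c))) := by
      intro y i
      ext (a | c) <;> simp [ρ]
    constructor
    · rintro ⟨y, hy⟩
      refine ⟨fun i c => y (Sum.inl (i, c)), ?_, ?_⟩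
      · intro i j hij
        by_contra hne
        have h1 := hy (D i j) (Or.inr ⟨i, j, hne, rfl⟩)
        have h2 : ∀ c, y (Sum.inl (i, c)) = y (Sum.inl (j, c)) := fun c => congrFun hij c
        simp [D, h2] at h1
      · intro i f hf
        have h1 := hy _ (Or.inl ⟨i, f, hf, rfl⟩)
        rw [MvPolynomial.eval_rename, hcomp] at h1
        exact h1
    · rintro ⟨x, hinj, hx⟩
      have hex : ∀ i j, ∃ w : κ → ℂ, i ≠ j → ∑ c, w c * (x i c - x j c) = 1 := by
        intro i j
        by_cases hij : i = j
        · exact ⟨0, fun h => absurd hij h⟩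
        · have : x i ≠ x j := fun h => hij (hinj h)
          obtain ⟨c, hc⟩ := Function.ne_iff.mp this
          refine ⟨Pi.single c (x i c - x j c)⁻¹, fun _ => ?_⟩
          rw [Finset.sum_eq_single c]
          · simp [inv_mul_cancel₀ (sub_ne_zero.mpr hc)]
          · intro b _ hb
            simp [hb]
          · simp
      choose w hw using hex
      refine ⟨Sum.elim (fun ic => x ic.1 ic.2) (fun ijc => w ijc.1 ijc.2.1 ijc.2.2), ?_⟩
      rintro f (⟨i, f0, hf0, rfl⟩ | ⟨i, j, hij, rfl⟩)
      · rw [MvPolynomial.eval_rename, hcomp]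
        exact hx i f0 hf0
      · simp [D, hw i j hij]
  rcases proj_dichotomy F' with ⟨h, hh, H⟩ | ⟨h, hh, H⟩
  · exact Or.inl ⟨h, hh, fun s hs => (key s).mp (H s hs)⟩
  · exact Or.inr ⟨h, hh, fun s hs hx => H s hs ((key s).mpr hx)⟩

theorem exists_family_iff {α : Type} (S : Set α) (k : ℕ) :
    (∃ x : Fin k → α, Function.Injective x ∧ ∀ i, x i ∈ S) ↔ (k : ℕ∞) ≤ S.encard := by
  constructor
  · rintro ⟨x, hx, hm⟩
    have h1 : (Set.range x).encard = k := by
      rw [← Set.image_univ, hx.encard_image]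
      simp
    rw [← h1]
    exact Set.encard_le_encard (by rintro _ ⟨i, rfl⟩; exact hm i)
  · intro h
    obtain ⟨t, ht, hc⟩ := Set.exists_subset_encard_eq h
    have hfin : t.Finite := Set.finite_of_encard_eq_coe hc
    have hcard : hfin.toFinset.card = k := by
      have := hfin.encard_eq_coe_toFinset_card
      rw [hc] at this
      exact_mod_cast this.symm
    refine ⟨fun i => (hfin.toFinset.equivFinOfCardEq hcard).symm i, ?_, ?_⟩
    · intro i j hij
      exact (hfin.toFinset.equivFinOfCardEq hcard).symm.injective (Subtype.ext hij)
    · intro i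
      exact ht (hfin.mem_toFinset.mp ((hfin.toFinset.equivFinOfCardEq hcard).symm i).2)

/-- Generic constancy of the number of solutions. -/
theorem generic_card {σ κ : Type} [Fintype σ] [DecidableEq σ] [Fintype κ]
    (F : Set (MvPolynomial (σ ⊕ κ) ℂ)) (N : ℕ) (E : Set (σ → ℂ))
    (hE : ∀ h : MvPolynomial σ ℂ, h ≠ 0 → ∃ s ∈ E, MvPolynomial.eval s h ≠ 0)
    (hN : ∀ s ∈ E, {x : κ → ℂ | ∀ f ∈ F, MvPolynomial.eval (Sum.elim s x) f = 0}.encard = N) :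
    Generically (fun s : σ → ℂ =>
      {x : κ → ℂ | ∀ f ∈ F, MvPolynomial.eval (Sum.elim s x) f = 0}.encard = N) := by
  have e := fun (s : σ → ℂ) =>
    exists_family_iff {x : κ → ℂ | ∀ f ∈ F, MvPolynomial.eval (Sum.elim s x) f = 0}
  simp only [Set.mem_setOf_eq] at e
  rcases family_dichotomy F N with ⟨h1, hh1, H1⟩ | ⟨h1, hh1, H1⟩
  swap
  · exfalso
    obtain ⟨s, hs, hs1⟩ := hE h1 hh1
    apply H1 s hs1
    rw [e, hN s hs]
  rcases family_dichotomy F (N + 1) with ⟨h2, hh2, H2⟩ | ⟨h2, hh2, H2⟩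
  · exfalso
    obtain ⟨s, hs, hs1⟩ := hE h2 hh2
    have := H2 s hs1
    rw [e, hN s hs] at this
    have h3 : N + 1 ≤ N := by exact_mod_cast this
    omega
  refine ⟨h1 * h2, mul_ne_zero hh1 hh2, fun s hs => ?_⟩
  rw [map_mul] at hs
  have a1 := H1 s (left_ne_zero_of_mul hs)
  have a2 := H2 s (right_ne_zero_of_mul hs)
  rw [e] at a1 a2
  apply le_antisymm _ a1
  push Not at a2
  push_cast at a2
  exact Order.lt_add_one_iff_of_not_isMax (by simp) |>.mp a2



/-- Positions of the finite points: `z_0 = 0`, `z_1 = a`, `z_{k+2} = x_k`. -/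
def zN {K : Type} [Field K] {n : ℕ} (a : K) (x : Fin n → K) (t : ℕ) : K :=
  if t = 0 then 0 else if t = 1 then a else if h : t - 2 < n then x ⟨t - 2, h⟩ else 0

@[simp] theorem zN_zero {K : Type} [Field K] {n : ℕ} (a : K) (x : Fin n → K) :
    zN a x 0 = 0 := by simp [zN]

@[simp] theorem zN_one {K : Type} [Field K] {n : ℕ} (a : K) (x : Fin n → K) :
    zN a x 1 = a := by simp [zN]

@[simp] theorem zN_succ {K : Type} [Field K] {n : ℕ} (a : K) (x : Fin n → K) (k : Fin n) :
    zN a x (k + 2) = x k := by simp [zN]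

theorem colIdx_lt {m : ℕ} (c : ColIdx m) : (c.1.1 : ℕ) < c.1.2 := c.2.1

theorem colIdx_two_le {m : ℕ} (c : ColIdx m) : 2 ≤ (c.1.2 : ℕ) := by
  have h1 : (c.1.1 : ℕ) < c.1.2 := c.2.1
  have h2 := c.2.2
  omega

theorem colIdx_lt_m {m : ℕ} (c : ColIdx m) : (c.1.2 : ℕ) < m - 1 := c.1.2.2

theorem sum_zCoeff {m : ℕ} (hm : 4 ≤ m) (v : Fin (m - 3) → ℂ) (t : Fin (m - 1)) :
    ∑ k : Fin (m - 3), v k * zCoeff m t k.succ = zN 0 v t := by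
  have ht := t.2
  unfold zCoeff zN
  by_cases h0 : (t : ℕ) = 0
  · simp [h0]
  by_cases h1 : (t : ℕ) = 1
  · simp [h1]
  have h2 : (t : ℕ) - 2 < m - 3 := by omega
  rw [Finset.sum_eq_single (⟨(t : ℕ) - 2, h2⟩ : Fin (m - 3))]
  · simp only [h0, h1, h2, if_false, dif_pos]
    rw [if_pos]
    · simp
    · simp; omega
  · intro k _ hk
    rw [if_neg]
    · simp
    · intro h
      apply hk
      ext
      simp at h ⊢
      omega
  · simp

theorem sum_row {m : ℕ} (hm : 4 ≤ m) (v : Fin (m - 3) → ℂ) (c : ColIdx m) :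
    ∑ k : Fin (m - 3), v k * Lm m k.succ c = zN 0 v c.1.2 - zN 0 v c.1.1 := by
  rw [← sum_zCoeff hm, ← sum_zCoeff hm, ← Finset.sum_sub_distrib]
  apply Finset.sum_congr rfl
  intro k _
  simp [Lm, mul_sub]

theorem zN_one_eq {n : ℕ} (a : ℂ) (x : Fin n → ℂ) (t : ℕ) :
    zN a x t = zN 0 x t + (if t = 1 then a else 0) := by
  unfold zN
  by_cases h0 : t = 0
  · simp [h0]
  by_cases h1 : t = 1
  · simp [h1]
  simp [h0, h1]

theorem ell_Lm {m : ℕ} (hm : 4 ≤ m) (x : Fin (m - 3) → ℂ) (c : ColIdx m) :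
    ell ℂ (Lm m) x c = zN 1 x c.1.2 - zN 1 x c.1.1 := by
  unfold ell
  rw [sum_row hm, zN_one_eq 1 x c.1.2, zN_one_eq 1 x c.1.1]
  have : Lm m 0 c = (if (c.1.2 : ℕ) = 1 then 1 else 0) - (if (c.1.1 : ℕ) = 1 then 1 else 0) := by
    simp [Lm, zCoeff]
  rw [this]
  ring

/-- Contraction of the linear equations with a test vector. -/
theorem contraction {m : ℕ} (hm : 4 ≤ m) (s y : ColIdx m → ℂ)
    (h : ∀ k : Fin (m - 3), ∑ i : ColIdx m, Lm m k.succ i * s i * y i = 0)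
    (V : ℕ → ℂ) (h0 : V 0 = 0) (h1 : V 1 = 0) :
    ∑ c : ColIdx m, s c * (V c.1.2 - V c.1.1) * y c = 0 := by
  have hV : ∀ t : ℕ, t < m - 1 → zN 0 (fun k : Fin (m - 3) => V (k + 2)) t = V t := by
    intro t ht
    unfold zN
    by_cases e0 : t = 0
    · simp [e0, h0]
    by_cases e1 : t = 1
    · simp [e1, h1]
    have h2 : t - 2 < m - 3 := by omega
    have h3 : t - 2 + 2 = t := by omega
    simp [e0, e1, h2, h3]
  calc ∑ c : ColIdx m, s c * (V c.1.2 - V c.1.1) * y c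
      = ∑ c : ColIdx m, ∑ k : Fin (m - 3), V (k + 2) * (Lm m k.succ c * s c * y c) := by
        apply Finset.sum_congr rfl
        intro c _
        rw [← hV _ c.1.2.2, ← hV _ c.1.1.2, ← sum_row hm, Finset.mul_sum, Finset.sum_mul]
        apply Finset.sum_congr rfl
        intro k _
        ring
    _ = 0 := by
        rw [Finset.sum_comm]
        apply Finset.sum_eq_zero
        intro k _
        rw [← Finset.mul_sum, h k, mul_zero]

/-- The column `(a,b)`. -/
def col {m : ℕ} (a b : ℕ) (h : a < b ∧ b < m - 1 ∧ 2 ≤ b) : ColIdx m :=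
  ⟨(⟨a, by omega⟩, ⟨b, by omega⟩), by
    refine ⟨?_, ?_⟩
    · exact h.1
    · simp; omega⟩

theorem col_self {m : ℕ} (c : ColIdx m) (h) : col (c.1.1 : ℕ) (c.1.2 : ℕ) h = c := rfl

/-- Antisymmetric extension of a vector indexed by columns, with values in a ring. -/
def asym {m : ℕ} {R : Type} [Ring R] (y : ColIdx m → R) (a b : ℕ) : R :=
  if h : a < b ∧ b < m - 1 ∧ 2 ≤ b then y (col a b h)
  else if h : b < a ∧ a < m - 1 ∧ 2 ≤ a then - y (col b a h) else 0

/-- Pairs of vertices that carry a column. -/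
def Valid (m a b : ℕ) : Prop := a ≠ b ∧ a < m - 1 ∧ b < m - 1 ∧ (2 ≤ a ∨ 2 ≤ b)

theorem asym_col {m : ℕ} {R : Type} [Ring R] (y : ColIdx m → R) (c : ColIdx m) :
    asym y c.1.1 c.1.2 = y c := by
  unfold asym
  rw [dif_pos ⟨colIdx_lt c, colIdx_lt_m c, colIdx_two_le c⟩]
  rfl

theorem asym_swap {m : ℕ} {R : Type} [Ring R] (y : ColIdx m → R) (a b : ℕ) :
    asym y a b = - asym y b a := by
  unfold asym
  by_cases h1 : a < b ∧ b < m - 1 ∧ 2 ≤ b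
  · have h2 : ¬ (b < a ∧ a < m - 1 ∧ 2 ≤ a) := by omega
    simp [h1, h2]
  · by_cases h2 : b < a ∧ a < m - 1 ∧ 2 ≤ a
    · simp [h1, h2]
    · simp [h1, h2]

theorem valid_of_asym_ne {m : ℕ} {y : ColIdx m → ℂ} {a b : ℕ} (h : asym y a b ≠ 0) :
    Valid m a b := by
  unfold asym at h
  unfold Valid
  split_ifs at h with h1 h2
  · omega
  · omega
  · exact absurd rfl h

theorem asym_mem {m : ℕ} {a b : ℕ} (h : Valid m a b) :
    ∃ c : ColIdx m, ((c.1.1 : ℕ) = a ∧ (c.1.2 : ℕ) = b) ∨ ((c.1.1 : ℕ) = b ∧ (c.1.2 : ℕ) = a) := by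
  unfold Valid at h
  by_cases h1 : a < b
  · exact ⟨col a b (by omega), Or.inl ⟨rfl, rfl⟩⟩
  · exact ⟨col b a (by omega), Or.inr ⟨rfl, rfl⟩⟩

/-- The triangle relations. -/
def Tri {m : ℕ} (y : ColIdx m → ℂ) : Prop :=
  ∀ a b c, Valid m a b → Valid m b c → Valid m a c →
    asym y a b * asym y b c = asym y a c * (asym y a b + asym y b c)

theorem asym_eval {m : ℕ} (y : ColIdx m → ℂ) (a b : ℕ) :
    MvPolynomial.eval y (asym (fun c => (MvPolynomial.X c : MvPolynomial (ColIdx m) ℂ)) a b)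
      = asym y a b := by
  unfold asym
  split_ifs <;> simp

theorem asym_cone {m : ℕ} (hm : 4 ≤ m) (x : Fin (m - 3) → ℂ) (τ : ℂ) {a b : ℕ}
    (h : Valid m a b) :
    asym (fun c => τ / ell ℂ (Lm m) x c) a b = τ / (zN 1 x b - zN 1 x a) := by
  unfold Valid at h
  unfold asym
  split_ifs with h1 h2
  · beta_reduce
    rw [ell_Lm hm]
    rfl
  · beta_reduce
    rw [ell_Lm hm]
    show - (τ / (zN 1 x a - zN 1 x b)) = _
    rw [← div_neg, neg_sub]
  · omega

theorem tri_of_closure {m : ℕ} (hm : 4 ≤ m) {y : ColIdx m → ℂ}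
    (hy : y ∈ zarClosure ℂ (coneImage (Lm m))) : Tri y := by
  intro a b c hab hbc hac
  have := hy
    (let Y := asym (fun c => (MvPolynomial.X c : MvPolynomial (ColIdx m) ℂ));
      Y a b * Y b c - Y a c * (Y a b + Y b c)) ?_
  · simp only [map_sub, map_mul, map_add, asym_eval] at this
    exact sub_eq_zero.mp this
  · rintro w ⟨τ, x, hx, rfl⟩
    simp only [map_sub, map_mul, map_add, asym_eval]
    rw [asym_cone hm x τ hab, asym_cone hm x τ hbc, asym_cone hm x τ hac]
    have hne : ∀ {a b : ℕ}, Valid m a b → zN 1 x b - zN 1 x a ≠ 0 := by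
      intro a b h
      obtain ⟨e, he | he⟩ := asym_mem h
      · have := hx e
        rw [ell_Lm hm, he.1, he.2] at this
        exact this
      · have := hx e
        rw [ell_Lm hm, he.1, he.2] at this
        intro h'
        apply this
        linear_combination -h'
    have h1 := hne hab
    have h2 := hne hbc
    have h3 := hne hac
    field_simp
    ring

section structure_lemma

variable {m : ℕ} {s y : ColIdx m → ℂ}

theorem nbr_clique (ht : Tri y) {b a a' : ℕ}
    (ha : a = b ∨ asym y b a ≠ 0) (ha' : a' = b ∨ asym y b a' ≠ 0) (hv : Valid m a a') :
    asym y a a' ≠ 0 ∧ (asym y a a')⁻¹ = (asym y b a')⁻¹ - (asym y b a)⁻¹ := by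
  have hbb : asym y b b = 0 := by simp [asym]
  by_cases e : a = b
  · subst e
    rcases ha' with rfl | ha'
    · exact absurd rfl hv.1
    · exact ⟨ha', by simp [hbb]⟩
  have ha := ha.resolve_left e
  by_cases e' : a' = b
  · subst e'
    rw [asym_swap y a a']
    refine ⟨by simpa using ha, ?_⟩
    rw [hbb]
    simp
  have ha' := ha'.resolve_left e'
  have hva := valid_of_asym_ne ha
  have hva' := valid_of_asym_ne ha'
  have htri := ht a b a' (by unfold Valid at *; omega) hva' hv
  rw [asym_swap y a b] at htri
  have hne : asym y a a' ≠ 0 := by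
    intro h
    rw [h] at htri
    simp at htri
    tauto
  refine ⟨hne, ?_⟩
  field_simp
  linear_combination -htri

theorem nbr_closed (ht : Tri y) {b a w : ℕ} (hb : 2 ≤ b)
    (ha : a = b ∨ asym y b a ≠ 0) (hw : asym y a w ≠ 0) : w = b ∨ asym y b w ≠ 0 := by
  rcases ha with rfl | ha
  · exact Or.inr hw
  by_cases e : w = b
  · exact Or.inl e
  right
  have h1 := valid_of_asym_ne ha
  have h2 := valid_of_asym_ne hw
  have htri := ht b a w h1 h2 (by unfold Valid at *; omega)
  intro h
  rw [h] at htri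
  simp at htri
  tauto

theorem nbr_base (ht : Tri y)
    (hs : ∀ J : Finset (ColIdx m), J.Nonempty → ∑ c ∈ J, s c ≠ 0)
    (hc : ∀ V : ℕ → ℂ, V 0 = 0 → V 1 = 0 → ∑ c : ColIdx m, s c * (V c.1.2 - V c.1.1) * y c = 0)
    {b a : ℕ} (hb : 2 ≤ b) (ha : asym y b a ≠ 0) :
    asym y b 0 ≠ 0 ∧ asym y b 1 ≠ 0 ∧ (asym y b 1)⁻¹ - (asym y b 0)⁻¹ ≠ 0 := by
  classical
  by_contra hcon
  set N : ℕ → Prop := fun a => a = b ∨ asym y b a ≠ 0 with hN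
  set z : ℕ → ℂ := fun a => (asym y b a)⁻¹ with hz
  have hζ : ∃ ζ : ℂ, (N 0 → z 0 = ζ) ∧ (N 1 → z 1 = ζ) := by
    by_cases h0 : N 0
    · refine ⟨z 0, fun _ => rfl, fun h1 => ?_⟩
      have h0' := h0.resolve_left (by omega)
      have h1' := h1.resolve_left (by omega)
      by_contra h2
      exact hcon ⟨h0', h1', sub_ne_zero.mpr h2⟩
    · exact ⟨z 1, fun h => absurd h h0, fun _ => rfl⟩
  obtain ⟨ζ, hz0, hz1⟩ := hζ
  have key := hc (fun a => if N a then z a - ζ else 0)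
    (by split_ifs with h; · rw [hz0 h, sub_self]
        · rfl)
    (by split_ifs with h; · rw [hz1 h, sub_self]
        · rfl)
  have hterm : ∀ c : ColIdx m, s c * ((if N c.1.2 then z c.1.2 - ζ else 0)
      - (if N c.1.1 then z c.1.1 - ζ else 0)) * y c
      = if (N c.1.1 ∧ N c.1.2) then s c else 0 := by
    intro c
    have hval : Valid m c.1.1 c.1.2 :=
      ⟨(colIdx_lt c).ne, c.1.1.2, c.1.2.2, Or.inr (colIdx_two_le c)⟩
    by_cases h1 : N c.1.1
    · by_cases h2 : N c.1.2
      · obtain ⟨hne, hinv⟩ := nbr_clique ht h1 h2 hval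
        rw [asym_col] at hne hinv
        have hinv' : z c.1.2 - z c.1.1 = (y c)⁻¹ := hinv.symm
        simp only [h1, h2, if_true, and_self]
        have : z c.1.2 - ζ - (z c.1.1 - ζ) = (y c)⁻¹ := by rw [← hinv']; ring
        rw [this]
        field_simp
      · have : y c = 0 := by
          by_contra hne
          rw [← asym_col y c] at hne
          exact h2 (nbr_closed ht hb h1 hne)
        simp [this, h2]
    · by_cases h2 : N c.1.2
      · have : y c = 0 := by
          by_contra hne
          rw [← asym_col y c, asym_swap, neg_eq_zero] at hne
          exact h1 (nbr_closed ht hb h2 hne)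
        simp [this, h1]
      · simp [h1, h2]
  rw [Finset.sum_congr rfl (fun c _ => hterm c), ← Finset.sum_filter] at key
  refine hs _ ?_ key
  obtain ⟨c, hc'⟩ := asym_mem (valid_of_asym_ne ha)
  refine ⟨c, ?_⟩
  simp only [Finset.mem_filter, Finset.mem_univ, true_and, hN]
  rcases hc' with ⟨e1, e2⟩ | ⟨e1, e2⟩
  · rw [e1, e2]
    exact ⟨Or.inl rfl, Or.inr ha⟩
  · rw [e1, e2]
    exact ⟨Or.inr ha, Or.inl rfl⟩

/-- Structure of the points of the reciprocal linear space on `𝕃_s` for generic `s`. -/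
theorem structure_thm (hm : 4 ≤ m) (ht : Tri y) (hy : y ≠ 0)
    (hs : ∀ J : Finset (ColIdx m), J.Nonempty → ∑ c ∈ J, s c ≠ 0)
    (hc : ∀ V : ℕ → ℂ, V 0 = 0 → V 1 = 0 →
      ∑ c : ColIdx m, s c * (V c.1.2 - V c.1.1) * y c = 0) :
    ∃ W : Finset ℕ, W ⊆ Finset.Icc 1 (m - 3) ∧ W.Nonempty ∧ (∀ c, y c ≠ 0 ↔ c ∈ Iflat m W) ∧
      ∃ (x : Fin (m - 3) → ℂ) (τ : ℂ), τ ≠ 0 ∧ (∀ k : Fin (m - 3), (k : ℕ) + 1 ∉ W → x k = 0) ∧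
        ∀ c ∈ Iflat m W, ell ℂ (Lm m) x c ≠ 0 ∧ y c = τ / ell ℂ (Lm m) x c := by
  classical
  set W : Finset ℕ := (Finset.Icc 1 (m - 3)).filter (fun i => asym y (i + 1) 0 ≠ 0) with hW
  have hWmem : ∀ q : ℕ, 2 ≤ q → (asym y q 0 ≠ 0 ↔ ∃ i ∈ W, q = i + 1) := by
    intro q hq
    constructor
    · intro h
      have hv := valid_of_asym_ne h
      refine ⟨q - 1, ?_, by omega⟩
      have : q - 1 + 1 = q := by omega
      simp only [hW, Finset.mem_filter, Finset.mem_Icc, this]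
      unfold Valid at hv
      exact ⟨by omega, h⟩
    · rintro ⟨i, hi, rfl⟩
      simp only [hW, Finset.mem_filter] at hi
      exact hi.2
  have hsupp : ∀ c, y c ≠ 0 ↔ c ∈ Iflat m W := by
    intro c
    have h2 := colIdx_two_le c
    have hlt := colIdx_lt c
    constructor
    · intro hne
      have h1 : asym y c.1.1 c.1.2 ≠ 0 := by rwa [asym_col]
      have h1' : asym y c.1.2 c.1.1 ≠ 0 := by rwa [asym_swap, neg_ne_zero]
      refine ⟨(hWmem _ h2).mp (nbr_base ht hs hc h2 h1').1, ?_⟩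
      by_cases e0 : (c.1.1 : ℕ) = 0
      · exact Or.inl e0
      by_cases e1 : (c.1.1 : ℕ) = 1
      · exact Or.inr (Or.inl e1)
      have h3 : 2 ≤ (c.1.1 : ℕ) := by omega
      exact Or.inr (Or.inr ((hWmem _ h3).mp (nbr_base ht hs hc h3 h1).1))
    · rintro ⟨hq, hp⟩
      have hq0 := (hWmem _ h2).mpr hq
      have hq1 := (nbr_base ht hs hc h2 hq0).2.1
      have : asym y c.1.2 c.1.1 ≠ 0 := by
        by_cases e0 : (c.1.1 : ℕ) = 0
        · rwa [e0]
        by_cases e1 : (c.1.1 : ℕ) = 1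
        · rwa [e1]
        have h3 : 2 ≤ (c.1.1 : ℕ) := by omega
        have hp0 := (hWmem _ h3).mpr ((hp.resolve_left e0).resolve_left e1)
        have hp0' : asym y 0 c.1.1 ≠ 0 := by rwa [asym_swap, neg_ne_zero]
        exact (nbr_closed ht h2 (Or.inr hq0) hp0').resolve_left (by omega)
      rw [asym_swap, neg_ne_zero, asym_col] at this
      exact this
  have hWne : W.Nonempty := by
    obtain ⟨c, hc'⟩ := Function.ne_iff.mp hy
    obtain ⟨⟨i, hi, -⟩, -⟩ := (hsupp c).mp hc'
    exact ⟨i, hi⟩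
  refine ⟨W, Finset.filter_subset _ _, hWne, hsupp, ?_⟩
  obtain ⟨i₀, hi₀⟩ := hWne
  have hi₁ : 1 ≤ i₀ := by
    have := Finset.filter_subset _ _ hi₀
    rw [Finset.mem_Icc] at this
    exact this.1
  set b := i₀ + 1 with hb
  have hb2 : 2 ≤ b := by omega
  have hb0 : asym y b 0 ≠ 0 := (hWmem b hb2).mpr ⟨i₀, hi₀, rfl⟩
  obtain ⟨-, hb1, hdiff⟩ := nbr_base ht hs hc hb2 hb0
  set z : ℕ → ℂ := fun a => (asym y b a)⁻¹ with hz
  have hNW : ∀ i ∈ W, i + 1 = b ∨ asym y b (i + 1) ≠ 0 := by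
    intro i hi
    have hi1 : 1 ≤ i := by
      have := Finset.filter_subset _ _ hi
      rw [Finset.mem_Icc] at this
      exact this.1
    have h1 := (hWmem (i + 1) (by omega)).mpr ⟨i, hi, rfl⟩
    have h2 : asym y 0 (i + 1) ≠ 0 := by rwa [asym_swap, neg_ne_zero]
    exact nbr_closed ht hb2 (Or.inr hb0) h2
  have hδ : z 1 - z 0 ≠ 0 := hdiff
  set x : Fin (m - 3) → ℂ := fun k =>
    if (k : ℕ) + 1 ∈ W then (z (k + 2) - z 0) / (z 1 - z 0) else 0 with hx
  have hzx : ∀ t : ℕ, (t = 0 ∨ t = 1 ∨ ∃ i ∈ W, t = i + 1) →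
      zN 1 x t = (z t - z 0) / (z 1 - z 0) := by
    intro t ht
    by_cases e0 : t = 0
    · subst e0; simp
    by_cases e1 : t = 1
    · subst e1; simp [div_self hδ]
    obtain ⟨i, hi, rfl⟩ := (ht.resolve_left e0).resolve_left e1
    have hi' := Finset.filter_subset _ _ hi
    rw [Finset.mem_Icc] at hi'
    have h1 : i - 1 < m - 3 := by omega
    have h2 : i + 1 = ((⟨i - 1, h1⟩ : Fin (m - 3)) : ℕ) + 2 := by simp; omega
    have h3 : i - 1 + 1 = i := by omega
    have h4 : i - 1 + 2 = i + 1 := by omega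
    conv_lhs => rw [h2]
    rw [zN_succ]
    simp only [hx, h3, hi, if_true, h4]
  have hNt : ∀ t : ℕ, (t = 0 ∨ t = 1 ∨ ∃ i ∈ W, t = i + 1) → t = b ∨ asym y b t ≠ 0 := by
    rintro t (rfl | rfl | ⟨i, hi, rfl⟩)
    · exact Or.inr hb0
    · exact Or.inr hb1
    · exact hNW i hi
  refine ⟨x, (z 1 - z 0)⁻¹, inv_ne_zero hδ, ?_, ?_⟩
  · intro k hk
    simp [hx, hk]
  · intro c hc'
    have hval : Valid m c.1.1 c.1.2 :=
      ⟨(colIdx_lt c).ne, c.1.1.2, c.1.2.2, Or.inr (colIdx_two_le c)⟩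
    have t1 := hc'.2
    have t2 : (c.1.2 : ℕ) = 0 ∨ (c.1.2 : ℕ) = 1 ∨ ∃ i ∈ W, (c.1.2 : ℕ) = i + 1 :=
      Or.inr (Or.inr hc'.1)
    obtain ⟨hne, hinv⟩ := nbr_clique ht (hNt _ t1) (hNt _ t2) hval
    rw [asym_col] at hne hinv
    have hinv' : z c.1.2 - z c.1.1 = (y c)⁻¹ := hinv.symm
    have he : ell ℂ (Lm m) x c = (y c)⁻¹ / (z 1 - z 0) := by
      rw [ell_Lm hm, hzx _ t1, hzx _ t2, ← hinv']
      ring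
    rw [he]
    refine ⟨div_ne_zero (inv_ne_zero hne) hδ, ?_⟩
    field_simp

end structure_lemma



theorem zarClosure_minimal {κ : Type} [Fintype κ] [DecidableEq κ] {S T : Set (κ → ℂ)}
    (h : S ⊆ zarClosure ℂ T) : zarClosure ℂ S ⊆ zarClosure ℂ T := by
  intro v hv f hf
  exact hv f (fun w hw => h hw f hf)

theorem subset_zarClosure {κ : Type} [Fintype κ] [DecidableEq κ] (S : Set (κ → ℂ)) :
    S ⊆ zarClosure ℂ S := fun _ hv _ hf => hf _ hv

theorem zarClosure_smul {κ : Type} [Fintype κ] [DecidableEq κ] {S : Set (κ → ℂ)}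
    (hS : ∀ (a : ℂ), ∀ v ∈ S, a • v ∈ S) (a : ℂ) {v : κ → ℂ} (hv : v ∈ zarClosure ℂ S) :
    a • v ∈ zarClosure ℂ S := by
  intro f hf
  have h1 := hv (MvPolynomial.bind₁ (fun i => MvPolynomial.C a * MvPolynomial.X i) f) ?_
  · rw [← MvPolynomial.aeval_eq_eval, MvPolynomial.aeval_bind₁] at h1
    rw [← MvPolynomial.aeval_eq_eval]
    simpa [Pi.smul_def] using h1
  · intro w hw
    have h2 := hf _ (hS a w hw)
    rw [← MvPolynomial.aeval_eq_eval, MvPolynomial.aeval_bind₁]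
    rw [← MvPolynomial.aeval_eq_eval] at h2
    simpa [Pi.smul_def] using h2

theorem coneImage_smul {m : ℕ} (a : ℂ) (v : ColIdx m → ℂ) (hv : v ∈ coneImage (Lm m)) :
    a • v ∈ coneImage (Lm m) := by
  obtain ⟨c, x, hx, rfl⟩ := hv
  refine ⟨a * c, x, hx, ?_⟩
  ext i
  simp [mul_div_assoc]

theorem coneImageSub_smul {m : ℕ} (I : Set (ColIdx m)) (a : ℂ) (v : ColIdx m → ℂ)
    (hv : v ∈ coneImageSub (Lm m) I) : a • v ∈ coneImageSub (Lm m) I := by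
  classical
  obtain ⟨c, x, hx, rfl⟩ := hv
  refine ⟨a * c, x, hx, ?_⟩
  ext i
  by_cases h : i ∈ I <;> simp [h, mul_div_assoc]

theorem coneImageSub_subset {m : ℕ} (hm : 4 ≤ m) (W : Finset ℕ) :
    coneImageSub (Lm m) (Iflat m W) ⊆ zarClosure ℂ (coneImage (Lm m)) := by
  classical
  rintro v ⟨τ, x, hx, rfl⟩ f hf
  let P : ℕ → Prop := fun t => t = 0 ∨ t = 1 ∨ ∃ i ∈ W, t = i + 1
  let xn : ℕ → Fin (m - 3) → ℂ := fun n k => if P (k + 2) then x k else n * ((k : ℕ) + 2 : ℕ)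
  let α : ℕ → ℂ := fun t => if P t then zN 1 x t else 0
  let β : ℕ → ℂ := fun t => if P t then 0 else (t : ℂ)
  have hz : ∀ n t, t < m - 1 → zN 1 (xn n) t = α t + n * β t := by
    intro n t ht
    by_cases e0 : t = 0
    · subst e0; simp [α, β, P]
    by_cases e1 : t = 1
    · subst e1; simp [α, β, P]
    obtain ⟨k, rfl⟩ : ∃ k, t = k + 2 := ⟨t - 2, by omega⟩
    have hk : k < m - 3 := by omega
    have h1 := zN_succ (1 : ℂ) (xn n) ⟨k, hk⟩
    have h2 := zN_succ (1 : ℂ) x ⟨k, hk⟩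
    simp only at h1 h2
    rw [h1]
    simp only [xn, α, β, h2]
    split_ifs <;> simp
  have hI : ∀ c : ColIdx m, c ∈ Iflat m W ↔ P c.1.1 ∧ P c.1.2 := by
    intro c
    have := colIdx_two_le c
    constructor
    · rintro ⟨h1, h2⟩
      exact ⟨h2, Or.inr (Or.inr h1)⟩
    · rintro ⟨h1, h2⟩
      exact ⟨(h2.resolve_left (by omega)).resolve_left (by omega), h1⟩
  have hell : ∀ n c, ell ℂ (Lm m) (xn n) c = (α c.1.2 - α c.1.1) + n * (β c.1.2 - β c.1.1) := by
    intro n c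
    rw [ell_Lm hm, hz n _ c.1.2.2, hz n _ c.1.1.2]
    ring
  have hellI : ∀ n, ∀ c ∈ Iflat m W, ell ℂ (Lm m) (xn n) c = ell ℂ (Lm m) x c := by
    intro n c hc
    rw [hell, ell_Lm hm]
    obtain ⟨h1, h2⟩ := (hI c).mp hc
    simp [α, β, h1, h2]
  have hB : ∀ c, c ∉ Iflat m W → β c.1.2 - β c.1.1 ≠ 0 := by
    intro c hc
    rw [hI] at hc
    have h2 := colIdx_two_le c
    have hlt := colIdx_lt c
    have hq : ((c.1.2 : ℕ) : ℂ) ≠ 0 := by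
      have : (c.1.2 : ℕ) ≠ 0 := by omega
      exact_mod_cast this
    simp only [β]
    split_ifs with a1 a2 a2
    · exact absurd ⟨a2, a1⟩ hc
    · have : (c.1.1 : ℕ) ≠ 0 := fun h => a2 (Or.inl h)
      rw [zero_sub, neg_ne_zero]
      exact_mod_cast this
    · simpa using hq
    · rw [sub_ne_zero]
      have : (c.1.2 : ℕ) ≠ c.1.1 := by omega
      exact_mod_cast this
  have hcob : ∀ c, c ∉ Iflat m W → Filter.Tendsto (fun n : ℕ => ell ℂ (Lm m) (xn n) c)
      Filter.atTop (Bornology.cobounded ℂ) := by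
    intro c hc
    simp only [hell]
    have h1 : Filter.Tendsto (fun n : ℕ => (n : ℂ)) Filter.atTop (Bornology.cobounded ℂ) := by
      rw [tendsto_norm_atTop_iff_cobounded.symm]
      simpa using tendsto_natCast_atTop_atTop (R := ℝ)
    have h2 := (Filter.tendsto_mul_right_cobounded (hB c hc)).comp h1
    exact (tendsto_const_add_cobounded (α c.1.2 - α c.1.1)).comp h2
  have hev : ∀ᶠ n in Filter.atTop, xn n ∈ complementX (Lm m) := by
    have : ∀ c : ColIdx m, ∀ᶠ n in Filter.atTop, ell ℂ (Lm m) (xn n) c ≠ 0 := by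
      intro c
      by_cases hc : c ∈ Iflat m W
      · filter_upwards with n
        rw [hellI n c hc]
        exact hx c hc
      · exact (hcob c hc).eventually (Bornology.eventually_ne_cobounded 0)
    exact Filter.eventually_all.mpr this
  have hlim : Filter.Tendsto (fun n : ℕ => (fun c => τ / ell ℂ (Lm m) (xn n) c))
      Filter.atTop (nhds ((Iflat m W).indicator (fun i => τ / ell ℂ (Lm m) x i))) := by
    rw [tendsto_pi_nhds]
    intro c
    by_cases hc : c ∈ Iflat m W
    · simp only [Set.indicator_of_mem hc, hellI _ c hc]
      exact tendsto_const_nhds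
    · rw [Set.indicator_of_notMem hc]
      simp only [div_eq_mul_inv]
      have := (Filter.tendsto_inv₀_cobounded.comp (hcob c hc)).const_mul τ
      simpa using this
  have hcont := ((MvPolynomial.continuous_eval f).tendsto _).comp hlim
  refine tendsto_nhds_unique hcont ?_
  refine tendsto_const_nhds.congr' ?_
  filter_upwards [hev] with n hn
  exact (hf _ ⟨τ, xn n, hn, rfl⟩).symm



/-- The flat `I_r(W)` as a finset. -/
def Ifin (m : ℕ) (W : Finset ℕ) : Finset (ColIdx m) := by
  classical exact Finset.univ.filter (fun c => c ∈ Iflat m W)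

theorem mem_Ifin {m : ℕ} {W : Finset ℕ} {c : ColIdx m} : c ∈ Ifin m W ↔ c ∈ Iflat m W := by
  classical
  simp [Ifin]

/-- The free coordinates attached to `W`. -/
abbrev VW (m : ℕ) (W : Finset ℕ) : Type := {k : Fin (m - 3) // (k : ℕ) + 1 ∈ W}

theorem card_VW {m : ℕ} {W : Finset ℕ} (hW : W ⊆ Finset.Icc 1 (m - 3)) :
    Fintype.card (VW m W) = W.card := by
  classical
  rw [← Fintype.card_coe W]
  refine Fintype.card_of_bijective (f := fun k : VW m W => (⟨k.1 + 1, k.2⟩ : W)) ⟨?_, ?_⟩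
  · rintro ⟨a, ha⟩ ⟨b, hb⟩ h
    simp only [Subtype.mk.injEq, Nat.add_right_cancel_iff] at h
    exact Subtype.ext (Fin.ext h)
  · rintro ⟨i, hi⟩
    have := Finset.mem_Icc.mp (hW hi)
    have h1 : i - 1 + 1 = i := by omega
    refine ⟨⟨⟨i - 1, by omega⟩, by simpa [h1] using hi⟩, ?_⟩
    simp [h1]

theorem Iflat_cases {m : ℕ} {W : Finset ℕ} (hW : W ⊆ Finset.Icc 1 (m - 3)) {c : ColIdx m}
    (hc : c ∈ Iflat m W) : ∃ l : VW m W, (c.1.2 : ℕ) = l.1 + 2 ∧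
      ((c.1.1 : ℕ) = 0 ∨ (c.1.1 : ℕ) = 1 ∨ ∃ k : VW m W, k ≠ l ∧ (c.1.1 : ℕ) = k.1 + 2) := by
  obtain ⟨⟨i, hi, h1⟩, h2⟩ := hc
  have hlt := colIdx_lt c
  have hi' := Finset.mem_Icc.mp (hW hi)
  have e1 : i - 1 + 1 = i := by omega
  refine ⟨⟨⟨i - 1, by omega⟩, by simpa [e1] using hi⟩, by simp; omega, ?_⟩
  rcases h2 with h2 | h2 | ⟨j, hj, h2⟩
  · exact Or.inl h2
  · exact Or.inr (Or.inl h2)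
  · have hj' := Finset.mem_Icc.mp (hW hj)
    have e2 : j - 1 + 1 = j := by omega
    refine Or.inr (Or.inr ⟨⟨⟨j - 1, by omega⟩, by simpa [e2] using hj⟩, ?_, by simp; omega⟩)
    intro h
    simp only [Subtype.mk.injEq, Fin.mk.injEq] at h
    omega

theorem col0_mem {m : ℕ} {W : Finset ℕ} (l : VW m W) :
    col 0 ((l.1 : ℕ) + 2) (by have := l.1.2; omega) ∈ Iflat m W := by
  have e : ((l.1 : ℕ) + 2) = (l.1 : ℕ) + 1 + 1 := rfl
  exact ⟨⟨_, l.2, e⟩, Or.inl rfl⟩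

theorem col1_mem {m : ℕ} {W : Finset ℕ} (l : VW m W) :
    col 1 ((l.1 : ℕ) + 2) (by have := l.1.2; omega) ∈ Iflat m W := by
  have e : ((l.1 : ℕ) + 2) = (l.1 : ℕ) + 1 + 1 := rfl
  exact ⟨⟨_, l.2, e⟩, Or.inr (Or.inl rfl)⟩

theorem col2_mem {m : ℕ} {W : Finset ℕ} (k l : VW m W) (h : k.1 < l.1) :
    col ((k.1 : ℕ) + 2) ((l.1 : ℕ) + 2) (by have := l.1.2; omega) ∈ Iflat m W := by
  have e : ((l.1 : ℕ) + 2) = (l.1 : ℕ) + 1 + 1 := rfl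
  have e' : ((k.1 : ℕ) + 2) = (k.1 : ℕ) + 1 + 1 := rfl
  exact ⟨⟨_, l.2, e⟩, Or.inr (Or.inr ⟨_, k.2, e'⟩)⟩

/-- Real linear forms. -/
def ellR {m : ℕ} (r : Fin (m - 3) → ℝ) (c : ColIdx m) : ℝ := zN 1 r c.1.2 - zN 1 r c.1.1

/-- Real solutions of the scattering equations of the particles `1, 2, m, W`. -/
structure RSol (m : ℕ) (W : Finset ℕ) (w : ColIdx m → ℝ) (r : Fin (m - 3) → ℝ) : Prop where
  off : ∀ k : Fin (m - 3), (k : ℕ) + 1 ∉ W → r k = 0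
  ne : ∀ c ∈ Iflat m W, ellR r c ≠ 0
  eq : ∀ V : ℕ → ℝ, V 0 = 0 → V 1 = 0 →
    ∑ c ∈ Ifin m W, w c * (V c.1.2 - V c.1.1) / ellR r c = 0

/-- The region of a given ordering. -/
structure Region (m : ℕ) (W : Finset ℕ) {n : ℕ} (e : VW m W ≃ Fin n) (r : Fin (m - 3) → ℝ) :
    Prop where
  off : ∀ k : Fin (m - 3), (k : ℕ) + 1 ∉ W → r k = 0
  pos : ∀ k : VW m W, 0 < r k
  lt : ∀ k : VW m W, r k < 1
  mono : ∀ k l : VW m W, e k < e l → r k < r l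

section count

variable {m : ℕ} {W : Finset ℕ} {w : ColIdx m → ℝ} {n : ℕ}

theorem region_mul_pos (hW : W ⊆ Finset.Icc 1 (m - 3)) {e : VW m W ≃ Fin n}
    {r r' : Fin (m - 3) → ℝ} (hr : Region m W e r) (hr' : Region m W e r')
    {c : ColIdx m} (hc : c ∈ Iflat m W) : 0 < ellR r c * ellR r' c := by
  obtain ⟨l, hl, h⟩ := Iflat_cases hW hc
  unfold ellR
  rw [hl, zN_succ, zN_succ]
  rcases h with h | h | ⟨k, hkl, h⟩
  · rw [h, zN_zero, zN_zero, sub_zero, sub_zero]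
    exact mul_pos (hr.pos l) (hr'.pos l)
  · rw [h, zN_one, zN_one]
    exact mul_pos_of_neg_of_neg (sub_neg.mpr (hr.lt l)) (sub_neg.mpr (hr'.lt l))
  · rw [h, zN_succ, zN_succ]
    rcases lt_or_gt_of_ne (fun h' => hkl (e.injective h')) with h' | h'
    · exact mul_pos (sub_pos.mpr (hr.mono _ _ h')) (sub_pos.mpr (hr'.mono _ _ h'))
    · exact mul_pos_of_neg_of_neg (sub_neg.mpr (hr.mono _ _ h')) (sub_neg.mpr (hr'.mono _ _ h'))

theorem rsol_unique (hW : W ⊆ Finset.Icc 1 (m - 3)) (hw : ∀ c, 0 < w c) {e : VW m W ≃ Fin n}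
    {r r' : Fin (m - 3) → ℝ} (hr : Region m W e r) (hr' : Region m W e r')
    (hs : RSol m W w r) (hs' : RSol m W w r') : r = r' := by
  have h1 := hs.eq (fun t => zN 1 r t - zN 1 r' t) (by simp) (by simp)
  have h2 := hs'.eq (fun t => zN 1 r t - zN 1 r' t) (by simp) (by simp)
  have h3 : ∑ c ∈ Ifin m W, w c * (ellR r c - ellR r' c) ^ 2 / (ellR r c * ellR r' c) = 0 := by
    have : ∑ c ∈ Ifin m W, w c * (ellR r c - ellR r' c) ^ 2 / (ellR r c * ellR r' c)
      = ∑ c ∈ Ifin m W, (w c * ((fun t => zN 1 r t - zN 1 r' t) (c.1.2 : ℕ)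
            - (fun t => zN 1 r t - zN 1 r' t) (c.1.1 : ℕ)) / ellR r' c
          - w c * ((fun t => zN 1 r t - zN 1 r' t) (c.1.2 : ℕ)
            - (fun t => zN 1 r t - zN 1 r' t) (c.1.1 : ℕ)) / ellR r c) := by
      apply Finset.sum_congr rfl
      intro c hc
      have a1 := hs.ne c (mem_Ifin.mp hc)
      have a2 := hs'.ne c (mem_Ifin.mp hc)
      have a3 : (fun t => zN 1 r t - zN 1 r' t) (c.1.2 : ℕ)
            - (fun t => zN 1 r t - zN 1 r' t) (c.1.1 : ℕ) = ellR r c - ellR r' c := by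
        simp only [ellR]
        ring
      rw [a3]
      field_simp
    rw [this, Finset.sum_sub_distrib, h1, h2, sub_zero]
  rw [Finset.sum_eq_zero_iff_of_nonneg] at h3
  · ext k
    by_cases hk : (k : ℕ) + 1 ∈ W
    · have h4 := h3 _ (mem_Ifin.mpr (col0_mem (m := m) (W := W) ⟨k, hk⟩))
      have a := region_mul_pos hW hr hr' (col0_mem (m := m) (W := W) ⟨k, hk⟩)
      rw [div_eq_zero_iff] at h4
      have h5 := h4.resolve_right a.ne'
      have h6 := (mul_eq_zero.mp h5).resolve_left (hw _).ne'
      have h7 : ellR r (col 0 ((k : ℕ) + 2) (by have := k.2; omega)) -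
        ellR r' (col 0 ((k : ℕ) + 2) (by have := k.2; omega)) = 0 := pow_eq_zero_iff (two_ne_zero) |>.mp h6
      simp only [ellR, col, zN_zero, zN_succ, sub_zero] at h7
      exact sub_eq_zero.mp h7
    · rw [hs.off k hk, hs'.off k hk]
  · intro c hc
    have a := region_mul_pos hW hr hr' (mem_Ifin.mp hc)
    have := hw c
    positivity

theorem rsol_mem_Ioo (hW : W ⊆ Finset.Icc 1 (m - 3)) (hw : ∀ c, 0 < w c)
    {r : Fin (m - 3) → ℝ} (hs : RSol m W w r) (k : VW m W) : 0 < r k ∧ r k < 1 := by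
  set φ : ℝ → ℝ := fun t => max (t - 1) 0 + min t 0 with hφ
  have hmono : Monotone φ := by
    intro a b hab
    simp only [hφ]
    gcongr
  have h1 := hs.eq (fun t => φ (zN 1 r t)) (by simp [hφ]) (by simp [hφ])
  rw [Finset.sum_eq_zero_iff_of_nonneg] at h1
  · have h4 := h1 _ (mem_Ifin.mpr (col0_mem k))
    have hne0 := hs.ne _ (col0_mem k)
    have hne1 := hs.ne _ (col1_mem k)
    rw [div_eq_zero_iff] at h4
    have h5 := (mul_eq_zero.mp (h4.resolve_right hne0)).resolve_left (hw _).ne'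
    simp only [col, zN_zero, zN_succ] at h5
    simp only [ellR, col, zN_zero, zN_one, zN_succ] at hne0 hne1
    simp only [hφ] at h5
    rw [sub_zero] at hne0
    rw [sub_ne_zero] at hne1
    rcases lt_trichotomy (r k) 0 with h | h | h
    · rw [max_eq_right (by linarith), min_eq_left (by linarith)] at h5
      simp at h5
      exact absurd h5 hne0
    · exact absurd h hne0
    · rcases lt_trichotomy (r k) 1 with h' | h' | h'
      · exact ⟨h, h'⟩
      · exact absurd h' hne1
      · rw [max_eq_left (by linarith), min_eq_right (by linarith)] at h5
        simp at h5
        linarith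
  · intro c hc
    rw [mul_div_assoc]
    apply mul_nonneg (hw c).le
    unfold ellR
    rcases le_total (zN 1 r c.1.2) (zN 1 r c.1.1) with h | h
    · exact div_nonneg_of_nonpos (sub_nonpos.mpr (hmono h)) (sub_nonpos.mpr h)
    · exact div_nonneg (sub_nonneg.mpr (hmono h)) (sub_nonneg.mpr h)

theorem rsol_ne {r : Fin (m - 3) → ℝ} (hs : ∀ c ∈ Iflat m W, ellR r c ≠ 0) {k l : VW m W}
    (hkl : k ≠ l) : r k ≠ r l := by
  rcases lt_or_gt_of_ne (fun h => hkl (Subtype.ext h) : k.1 ≠ l.1) with h | h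
  · have := hs _ (col2_mem k l h)
    simp only [ellR, col, zN_succ] at this
    exact (sub_ne_zero.mp this).symm
  · have := hs _ (col2_mem l k h)
    simp only [ellR, col, zN_succ] at this
    exact (sub_ne_zero.mp this)

theorem rsol_region (hW : W ⊆ Finset.Icc 1 (m - 3)) (hw : ∀ c, 0 < w c)
    {r : Fin (m - 3) → ℝ} (hs : RSol m W w r) (hn : W.card = n) :
    ∃ e : VW m W ≃ Fin n, Region m W e r := by
  classical
  have hinj : Function.Injective (fun v : VW m W => r v) := by
    intro k l h
    by_contra hne
    exact rsol_ne hs.ne hne h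
  set S : Finset ℝ := Finset.univ.image (fun v : VW m W => r v) with hS
  have hcard : S.card = n := by
    rw [hS, Finset.card_image_of_injective _ hinj, Finset.card_univ, card_VW hW, hn]
  let f : VW m W ≃ S := Equiv.ofBijective (fun v => ⟨r v, by simp [hS]⟩) ⟨by
    intro a b h
    exact hinj (congrArg Subtype.val h), by
    rintro ⟨t, ht⟩
    simp only [hS, Finset.mem_image, Finset.mem_univ, true_and] at ht
    obtain ⟨v, hv⟩ := ht
    exact ⟨v, Subtype.ext hv⟩⟩
  refine ⟨f.trans (S.orderIsoOfFin hcard).symm.toEquiv, hs.off,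
    fun k => (rsol_mem_Ioo hW hw hs k).1, fun k => (rsol_mem_Ioo hW hw hs k).2, ?_⟩
  intro k l h
  have h1 : (S.orderIsoOfFin hcard).symm (f k) < (S.orderIsoOfFin hcard).symm (f l) := h
  rw [OrderIso.lt_iff_lt] at h1
  exact h1

theorem region_inj {e e' : VW m W ≃ Fin n} {r : Fin (m - 3) → ℝ}
    (h : Region m W e r) (h' : Region m W e' r) : e = e' := by
  have key : ∀ {e : VW m W ≃ Fin n}, Region m W e r → ∀ k l, e k < e l ↔ r k < r l := by
    intro e h k l
    refine ⟨h.mono k l, fun hlt => ?_⟩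
    rcases lt_trichotomy (e k) (e l) with a | a | a
    · exact a
    · rw [e.injective a] at hlt
      exact absurd hlt (lt_irrefl _)
    · exact absurd (h.mono _ _ a) (not_lt.mpr hlt.le)
  have hm : StrictMono (e.symm.trans e') := by
    intro i j hij
    have h1 : e (e.symm i) < e (e.symm j) := by simpa using hij
    rw [key h, ← key h'] at h1
    exact h1
  let o : Fin n ≃o Fin n := StrictMono.orderIsoOfSurjective _ hm (e.symm.trans e').surjective
  have ho : o = OrderIso.refl _ := Subsingleton.elim _ _
  ext k
  have h1 : o (e k) = e k := by rw [ho]; rfl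
  have h2 : o (e k) = e' k := by
    show (e.symm.trans e') (e k) = e' k
    simp
  rw [← h1, h2]

end count


section exist
variable {m : ℕ} {W : Finset ℕ} {w : ColIdx m → ℝ} {n : ℕ}

theorem continuous_zN (t : ℕ) : Continuous (fun r : Fin n → ℝ => zN (1 : ℝ) r t) := by
  unfold zN
  split_ifs <;> fun_prop

theorem continuous_ellR (c : ColIdx m) : Continuous (fun r : Fin (m - 3) → ℝ => ellR r c) :=
  (continuous_zN _).sub (continuous_zN _)

/-- `z_t` is affine along coordinate lines. -/
theorem zN_line (r : Fin n → ℝ) (k : Fin n) (ε : ℝ) (t : ℕ) :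
    zN 1 (r + ε • Pi.single k 1) t = zN 1 r t + ε * (if t = k + 2 then 1 else 0) := by
  unfold zN
  by_cases h0 : t = 0
  · simp [h0]
  by_cases h1 : t = 1
  · simp [h1]
  by_cases h : t - 2 < n
  · simp only [h0, h1, h, if_false, dif_pos, Pi.add_apply, Pi.smul_apply, smul_eq_mul]
    congr 2
    by_cases hk : t = k + 2
    · have : (⟨t - 2, h⟩ : Fin n) = k := Fin.ext (by simp; omega)
      rw [if_pos hk, this, Pi.single_eq_same]
    · have : (⟨t - 2, h⟩ : Fin n) ≠ k := by
        intro h'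
        have := congrArg Fin.val h'
        simp at this
        omega
      rw [if_neg hk, Pi.single_eq_of_ne this]
  · have : t ≠ k + 2 := by have := k.2; omega
    simp [h0, h1, h, this]

theorem exists_rsol (hm : 4 ≤ m) (hW : W ⊆ Finset.Icc 1 (m - 3)) (hw : ∀ c, 0 < w c)
    (e : VW m W ≃ Fin n) : ∃ r, Region m W e r ∧ RSol m W w r := by
  classical
  set K : Set (Fin (m - 3) → ℝ) := {r | (∀ k : Fin (m - 3), (k : ℕ) + 1 ∉ W → r k = 0) ∧
    (∀ k, 0 ≤ r k) ∧ (∀ k, r k ≤ 1) ∧ (∀ k l : VW m W, e k < e l → r k ≤ r l)} with hK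
  have hKclosed : IsClosed K := by
    have : K = (⋂ k : Fin (m - 3), ⋂ _ : (k : ℕ) + 1 ∉ W, {r | r k = 0}) ∩
        ((⋂ k : Fin (m - 3), {r | 0 ≤ r k}) ∩ ((⋂ k : Fin (m - 3), {r | r k ≤ 1}) ∩
        (⋂ k : VW m W, ⋂ l : VW m W, ⋂ _ : e k < e l, {r | r k ≤ r l}))) := by
      ext r
      simp [hK]
    rw [this]
    refine IsClosed.inter ?_ (IsClosed.inter ?_ (IsClosed.inter ?_ ?_))
    · exact isClosed_iInter fun k => isClosed_iInter fun _ =>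
        isClosed_eq (continuous_apply k) continuous_const
    · exact isClosed_iInter fun k => isClosed_le continuous_const (continuous_apply k)
    · exact isClosed_iInter fun k => isClosed_le (continuous_apply k) continuous_const
    · exact isClosed_iInter fun k => isClosed_iInter fun l => isClosed_iInter fun _ =>
        isClosed_le (continuous_apply _) (continuous_apply _)
  have hKcomp : IsCompact K := by
    apply IsCompact.of_isClosed_subset (isCompact_Icc (a := (0 : Fin (m - 3) → ℝ)) (b := 1))
      hKclosed
    rintro r ⟨-, h1, h2, -⟩
    exact ⟨h1, h2⟩
  have hRK : ∀ r, Region m W e r → r ∈ K := by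
    intro r hr
    refine ⟨hr.off, fun k => ?_, fun k => ?_, fun k l h => (hr.mono k l h).le⟩
    · by_cases hk : (k : ℕ) + 1 ∈ W
      · exact (hr.pos ⟨k, hk⟩).le
      · rw [hr.off k hk]
    · by_cases hk : (k : ℕ) + 1 ∈ W
      · exact (hr.lt ⟨k, hk⟩).le
      · rw [hr.off k hk]
        exact zero_le_one
  set Pf : (Fin (m - 3) → ℝ) → ℝ := fun r => ∏ c ∈ Ifin m W, |ellR r c| ^ (w c) with hPf
  have hPc : Continuous Pf := by
    apply continuous_finsetProd
    intro c _
    exact (continuous_ellR c).abs.rpow_const (fun _ => Or.inr (hw c).le)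
  set r0 : Fin (m - 3) → ℝ := fun k =>
    if h : (k : ℕ) + 1 ∈ W then (((e ⟨k, h⟩ : Fin n) : ℝ) + 1) / (n + 1) else 0 with hr0
  have hr0V : ∀ k : VW m W, r0 k = (((e k : Fin n) : ℝ) + 1) / (n + 1) := by
    intro k
    simp only [hr0, k.2, dif_pos]
  have hn0 : (0 : ℝ) < n + 1 := by positivity
  have hreg0 : Region m W e r0 := by
    refine ⟨fun k hk => by simp [hr0, hk], fun k => ?_, fun k => ?_, fun k l h => ?_⟩
    · rw [hr0V]; positivity
    · rw [hr0V, div_lt_one hn0]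
      have : ((e k : Fin n) : ℝ) < n := by exact_mod_cast (e k).2
      linarith
    · rw [hr0V, hr0V]
      have : ((e k : Fin n) : ℝ) < ((e l : Fin n) : ℝ) := by exact_mod_cast h
      gcongr
  have hPpos : ∀ r, Region m W e r → 0 < Pf r := by
    intro r hr
    apply Finset.prod_pos
    intro c hc
    apply Real.rpow_pos_of_pos
    rw [abs_pos]
    intro h0
    have := region_mul_pos hW hr hr (mem_Ifin.mp hc)
    rw [h0] at this
    simp at this
  obtain ⟨r, hrK, hmax⟩ := hKcomp.exists_isMaxOn ⟨r0, hRK r0 hreg0⟩ hPc.continuousOn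
  have hPr : 0 < Pf r := lt_of_lt_of_le (hPpos r0 hreg0) (hmax (hRK r0 hreg0))
  have hne : ∀ c ∈ Iflat m W, ellR r c ≠ 0 := by
    intro c hc h0
    have : Pf r = 0 := by
      apply Finset.prod_eq_zero (mem_Ifin.mpr hc)
      rw [h0, abs_zero, Real.zero_rpow (hw c).ne']
    linarith
  have hreg : Region m W e r := by
    refine ⟨hrK.1, fun k => ?_, fun k => ?_, fun k l h => ?_⟩
    · have := hne _ (col0_mem k)
      simp only [ellR, col, zN_zero, zN_succ, sub_zero] at this
      exact lt_of_le_of_ne (hrK.2.1 k) this.symm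
    · have := hne _ (col1_mem k)
      simp only [ellR, col, zN_one, zN_succ, sub_ne_zero] at this
      exact lt_of_le_of_ne (hrK.2.2.1 k) this
    · refine lt_of_le_of_ne (hrK.2.2.2 k l h) (rsol_ne hne ?_)
      rintro rfl
      exact lt_irrefl _ h
  refine ⟨r, hreg, hreg.off, hne, ?_⟩
  have hcrit : ∀ k : VW m W, ∑ c ∈ Ifin m W, w c *
      ((if (c.1.2 : ℕ) = k.1 + 2 then 1 else 0) - (if (c.1.1 : ℕ) = k.1 + 2 then 1 else 0))
        / ellR r c = 0 := by
    intro k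
    set γ : ℝ → (Fin (m - 3) → ℝ) := fun ε => r + ε • Pi.single k.1 1 with hγ
    have hγc : Continuous γ := by fun_prop
    have hγ0 : γ 0 = r := by simp [hγ]
    have hell : ∀ ε c, ellR (γ ε) c = ellR r c + ε * ((if (c.1.2 : ℕ) = k.1 + 2 then 1 else 0)
        - (if (c.1.1 : ℕ) = k.1 + 2 then 1 else 0)) := by
      intro ε c
      simp only [ellR, hγ, zN_line]
      ring
    have hev : ∀ᶠ ε in nhds (0 : ℝ), Region m W e (γ ε) := by
      have h1 : ∀ᶠ ε in nhds (0 : ℝ), ∀ l : VW m W, 0 < γ ε l := by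
        rw [Filter.eventually_all]
        intro l
        have : Continuous fun ε => γ ε l := (continuous_apply l.1).comp hγc
        exact this.continuousAt.eventually (lt_mem_nhds (by beta_reduce; rw [hγ0]; exact hreg.pos l))
      have h2 : ∀ᶠ ε in nhds (0 : ℝ), ∀ l : VW m W, γ ε l < 1 := by
        rw [Filter.eventually_all]
        intro l
        have : Continuous fun ε => γ ε l := (continuous_apply l.1).comp hγc
        exact this.continuousAt.eventually (gt_mem_nhds (by beta_reduce; rw [hγ0]; exact hreg.lt l))
      have h3 : ∀ᶠ ε in nhds (0 : ℝ), ∀ a b : VW m W, e a < e b → γ ε a < γ ε b := by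
        rw [Filter.eventually_all]
        intro a
        rw [Filter.eventually_all]
        intro b
        by_cases hab : e a < e b
        · have c1 : Continuous fun ε => γ ε a := (continuous_apply a.1).comp hγc
          have c2 : Continuous fun ε => γ ε b := (continuous_apply b.1).comp hγc
          have := (c1.continuousAt (x := 0)).eventually_lt (c2.continuousAt (x := 0))
            (by rw [hγ0]; exact hreg.mono a b hab)
          filter_upwards [this] with ε h _
          exact h
        · exact Filter.Eventually.of_forall fun _ h => absurd h hab
      filter_upwards [h1, h2, h3] with ε a1 a2 a3
      refine ⟨fun l hl => ?_, a1, a2, a3⟩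
      have : l ≠ k.1 := by
        rintro rfl
        exact hl k.2
      simp [hγ, hreg.off l hl, this]
    set g : ℝ → ℝ := fun ε => ∑ c ∈ Ifin m W, w c * Real.log (ellR (γ ε) c) with hg
    have hlog : ∀ ε, Region m W e (γ ε) → g ε = Real.log (Pf (γ ε)) := by
      intro ε hε
      have hp : ∀ c ∈ Ifin m W, 0 < |ellR (γ ε) c| := by
        intro c hc
        rw [abs_pos]
        intro h0
        have := region_mul_pos hW hε hε (mem_Ifin.mp hc)
        rw [h0] at this
        simp at this
      simp only [hg, hPf]
      rw [Real.log_prod]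
      · apply Finset.sum_congr rfl
        intro c hc
        rw [Real.log_rpow (hp c hc), Real.log_abs]
      · intro c hc
        exact (Real.rpow_pos_of_pos (hp c hc) _).ne'
    have hloc : IsLocalMax g 0 := by
      filter_upwards [hev] with ε hε
      rw [hlog ε hε, hlog 0 (by rw [hγ0]; exact hreg)]
      apply Real.log_le_log (hPpos _ hε)
      rw [hγ0]
      exact hmax (hRK _ hε)
    have hder : HasDerivAt g (∑ c ∈ Ifin m W, w c *
      (((if (c.1.2 : ℕ) = k.1 + 2 then 1 else 0) - (if (c.1.1 : ℕ) = k.1 + 2 then 1 else 0))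
        / ellR r c)) 0 := by
      apply HasDerivAt.fun_sum
      intro c hc
      apply HasDerivAt.const_mul
      have h1 : HasDerivAt (fun ε => ellR (γ ε) c) ((if (c.1.2 : ℕ) = k.1 + 2 then 1 else 0)
        - (if (c.1.1 : ℕ) = k.1 + 2 then 1 else 0)) 0 := by
        simp only [hell]
        have := ((hasDerivAt_id (0 : ℝ)).mul_const ((if (c.1.2 : ℕ) = k.1 + 2 then (1 : ℝ) else 0)
          - (if (c.1.1 : ℕ) = k.1 + 2 then 1 else 0))).const_add (ellR r c)
        simpa using this
      have h2 := h1.log (by rw [hγ0]; exact hne c (mem_Ifin.mp hc))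
      rw [hγ0] at h2
      exact h2
    have := hloc.hasDerivAt_eq_zero hder
    refine Eq.trans (Finset.sum_congr rfl (fun c _ => ?_)) this
    rw [mul_div_assoc]
  intro V hV0 hV1
  have hexp : ∀ c ∈ Ifin m W, w c * (V c.1.2 - V c.1.1) / ellR r c
      = ∑ k : VW m W, V (k.1 + 2) * (w c * ((if (c.1.2 : ℕ) = k.1 + 2 then 1 else 0)
        - (if (c.1.1 : ℕ) = k.1 + 2 then 1 else 0)) / ellR r c) := by
    intro c hc
    have hsum : ∀ l : VW m W,
        ∑ k : VW m W, V (k.1 + 2) * (if (l.1 : ℕ) + 2 = k.1 + 2 then (1 : ℝ) else 0)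
          = V (l.1 + 2) := by
      intro l
      rw [Finset.sum_eq_single l]
      · simp
      · intro b _ hb
        have : (l.1 : ℕ) ≠ b.1 := fun h => hb (Subtype.ext (Fin.ext h.symm))
        simp [this]
      · simp
    have hrhs : ∑ k : VW m W, V (k.1 + 2) * (w c * ((if (c.1.2 : ℕ) = k.1 + 2 then 1 else 0)
        - (if (c.1.1 : ℕ) = k.1 + 2 then 1 else 0)) / ellR r c)
        = (w c / ellR r c) *
          (∑ k : VW m W, V (k.1 + 2) * (if (c.1.2 : ℕ) = k.1 + 2 then (1 : ℝ) else 0)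
          - ∑ k : VW m W, V (k.1 + 2) * (if (c.1.1 : ℕ) = k.1 + 2 then (1 : ℝ) else 0)) := by
      rw [← Finset.sum_sub_distrib, Finset.mul_sum]
      apply Finset.sum_congr rfl
      intro k _
      ring
    rw [hrhs]
    obtain ⟨l, hl, h⟩ := Iflat_cases hW (mem_Ifin.mp hc)
    rw [hl, hsum l]
    rcases h with h | h | ⟨j, hj, h⟩
    · rw [h, hV0]
      simp
      ring
    · rw [h, hV1]
      simp
      ring
    · rw [h, hsum j]
      ring
  rw [Finset.sum_congr rfl hexp, Finset.sum_comm]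
  apply Finset.sum_eq_zero
  intro k _
  rw [← Finset.mul_sum, hcrit k, mul_zero]

theorem encard_rsol (hm : 4 ≤ m) (hW : W ⊆ Finset.Icc 1 (m - 3)) (hw : ∀ c, 0 < w c) :
    {r | RSol m W w r}.encard = (W.card).factorial := by
  classical
  choose Φ hΦ1 hΦ2 using fun e : VW m W ≃ Fin W.card => exists_rsol (w := w) hm hW hw e
  have hinj : Function.Injective Φ := by
    intro e e' h
    apply region_inj (hΦ1 e)
    rw [h]
    exact hΦ1 e'
  have hrange : {r | RSol m W w r} = Set.range Φ := by
    ext r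
    constructor
    · intro hr
      obtain ⟨e, he⟩ := rsol_region hW hw hr rfl
      exact ⟨e, rsol_unique hW hw (hΦ1 e) he (hΦ2 e) hr⟩
    · rintro ⟨e, rfl⟩
      exact hΦ2 e
  rw [hrange, ← Set.image_univ, hinj.encard_image, Set.encard_univ,
    ENat.card_eq_coe_fintype_card]
  have e0 : VW m W ≃ Fin W.card := Fintype.equivFinOfCardEq (card_VW hW)
  rw [Fintype.card_equiv e0, card_VW hW]

end exist


/-- Reciprocal vector of a point, supported on the flat of `W`. -/
def uvec (m : ℕ) (W : Finset ℕ) (x : Fin (m - 3) → ℂ) : ColIdx m → ℂ :=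
  (Iflat m W).indicator (fun c => (ell ℂ (Lm m) x c)⁻¹)

/-- Complex solutions of the scattering equations for the particles `1, 2, m, W`. -/
structure CSol (m : ℕ) (W : Finset ℕ) (s : ColIdx m → ℂ) (x : Fin (m - 3) → ℂ) : Prop where
  off : ∀ k : Fin (m - 3), (k : ℕ) + 1 ∉ W → x k = 0
  ne : ∀ c ∈ Iflat m W, ell ℂ (Lm m) x c ≠ 0
  eq : ∀ k : Fin (m - 3), ∑ i : ColIdx m, Lm m k.succ i * s i * uvec m W x i = 0

theorem uvec_of_mem {m : ℕ} {W : Finset ℕ} {x : Fin (m - 3) → ℂ} {c : ColIdx m}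
    (hc : c ∈ Iflat m W) : uvec m W x c = (ell ℂ (Lm m) x c)⁻¹ := by
  simp [uvec, hc]

theorem uvec_of_not_mem {m : ℕ} {W : Finset ℕ} {x : Fin (m - 3) → ℂ} {c : ColIdx m}
    (hc : c ∉ Iflat m W) : uvec m W x c = 0 := by
  simp [uvec, hc]

theorem zN_ofReal {n : ℕ} (r : Fin n → ℝ) (t : ℕ) :
    zN (1 : ℂ) (fun k => (r k : ℂ)) t = ((zN 1 r t : ℝ) : ℂ) := by
  unfold zN
  split_ifs <;> simp

theorem ell_ofReal {m : ℕ} (hm : 4 ≤ m) (r : Fin (m - 3) → ℝ) (c : ColIdx m) :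
    ell ℂ (Lm m) (fun k => (r k : ℂ)) c = (ellR r c : ℂ) := by
  rw [ell_Lm hm, zN_ofReal, zN_ofReal, ellR]
  push_cast
  rfl

theorem sum_uvec {m : ℕ} {W : Finset ℕ} (x : Fin (m - 3) → ℂ) (f : ColIdx m → ℂ) :
    ∑ c, f c * uvec m W x c = ∑ c ∈ Ifin m W, f c * (ell ℂ (Lm m) x c)⁻¹ := by
  classical
  rw [← Finset.sum_subset (Finset.subset_univ (Ifin m W))]
  · apply Finset.sum_congr rfl
    intro c hc
    rw [uvec_of_mem (mem_Ifin.mp hc)]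
  · intro c _ hc
    rw [uvec_of_not_mem (fun h => hc (mem_Ifin.mpr h)), mul_zero]

theorem csol_im {m : ℕ} {W : Finset ℕ} (hm : 4 ≤ m)
    {w : ColIdx m → ℝ} (hw : ∀ c, 0 < w c) {x : Fin (m - 3) → ℂ}
    (h : CSol m W (fun c => (w c : ℂ)) x) (k : Fin (m - 3)) : (x k).im = 0 := by
  by_cases hk : (k : ℕ) + 1 ∈ W
  swap
  · rw [h.off k hk]; rfl
  have h1 := contraction hm (fun c => (w c : ℂ)) (uvec m W x) h.eq
    (fun t => (((zN 1 x t).im : ℝ) : ℂ)) (by simp) (by simp)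
  rw [sum_uvec x (fun c => (w c : ℂ) * ((((zN 1 x c.1.2).im : ℝ) : ℂ)
    - (((zN 1 x c.1.1).im : ℝ) : ℂ)))] at h1
  have h2 := congrArg Complex.im h1
  rw [Complex.im_sum] at h2
  have h3 : ∀ c ∈ Ifin m W, ((w c : ℂ) * ((((zN 1 x c.1.2).im : ℝ) : ℂ)
    - (((zN 1 x c.1.1).im : ℝ) : ℂ)) * (ell ℂ (Lm m) x c)⁻¹).im
      = - (w c * (ell ℂ (Lm m) x c).im ^ 2 / Complex.normSq (ell ℂ (Lm m) x c)) := by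
    intro c _
    have : (w c : ℂ) * ((((zN 1 x c.1.2).im : ℝ) : ℂ)
      - (((zN 1 x c.1.1).im : ℝ) : ℂ)) = ((w c * (ell ℂ (Lm m) x c).im : ℝ) : ℂ) := by
      rw [ell_Lm hm, Complex.sub_im]
      push_cast
      rfl
    rw [this, Complex.im_ofReal_mul, Complex.inv_im]
    ring
  rw [Finset.sum_congr rfl h3, Finset.sum_neg_distrib, Complex.zero_im, neg_eq_zero] at h2
  rw [Finset.sum_eq_zero_iff_of_nonneg] at h2
  · have h4 := h2 _ (mem_Ifin.mpr (col0_mem ⟨k, hk⟩))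
    have h5 := h.ne _ (col0_mem ⟨k, hk⟩)
    have h6 : ell ℂ (Lm m) x (col 0 ((k : ℕ) + 2) (by have := k.2; omega)) = x k := by
      rw [ell_Lm hm]
      simp [col]
    rw [h6] at h4 h5
    have h7 : Complex.normSq (x k) ≠ 0 := by simpa using h5
    have h8 := (hw (col 0 ((k : ℕ) + 2) (by have := k.2; omega))).ne'
    simpa [h7, h8, h5] using h4
  · intro c _
    have := (hw c).le
    have := Complex.normSq_nonneg (ell ℂ (Lm m) x c)
    positivity

theorem csol_iff {m : ℕ} {W : Finset ℕ} (hm : 4 ≤ m)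
    {w : ColIdx m → ℝ} (r : Fin (m - 3) → ℝ) :
    CSol m W (fun c => (w c : ℂ)) (fun k => (r k : ℂ)) ↔ RSol m W w r := by
  constructor
  · intro h
    refine ⟨fun k hk => by exact_mod_cast h.off k hk, fun c hc h0 => h.ne c hc ?_, ?_⟩
    · rw [ell_ofReal hm, h0]; rfl
    · intro V h0 h1
      have h2 := contraction hm _ _ h.eq (fun t => (V t : ℂ)) (by simp [h0]) (by simp [h1])
      rw [sum_uvec _ (fun c => (w c : ℂ) * ((V c.1.2 : ℂ) - (V c.1.1 : ℂ)))] at h2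
      have : ((∑ c ∈ Ifin m W, w c * (V c.1.2 - V c.1.1) / ellR r c : ℝ) : ℂ) = 0 := by
        rw [← h2]
        push_cast
        apply Finset.sum_congr rfl
        intro c _
        rw [ell_ofReal hm, div_eq_mul_inv]
      exact_mod_cast this
  · intro h
    refine ⟨fun k hk => by rw [h.off k hk]; rfl, fun c hc => ?_, ?_⟩
    · rw [ell_ofReal hm]
      exact_mod_cast h.ne c hc
    · intro k
      have h1 := h.eq (fun t => if t = k + 2 then 1 else 0) (by simp) (by simp)
      have h2 := congrArg (fun t : ℝ => (t : ℂ)) h1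
      simp only [Complex.ofReal_zero] at h2
      rw [sum_uvec _ (fun c => Lm m k.succ c * (w c : ℂ)), ← h2]
      push_cast
      apply Finset.sum_congr rfl
      intro c _
      rw [ell_ofReal hm, div_eq_mul_inv]
      congr 1
      have : Lm m k.succ c = (if (c.1.2 : ℕ) = k + 2 then 1 else 0)
          - (if (c.1.1 : ℕ) = k + 2 then 1 else 0) := by
        simp [Lm, zCoeff]
      rw [this, mul_comm]
      congr 2 <;> split_ifs <;> simp

theorem encard_csol {m : ℕ} {W : Finset ℕ} (hm : 4 ≤ m) (hW : W ⊆ Finset.Icc 1 (m - 3))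
    {w : ColIdx m → ℝ} (hw : ∀ c, 0 < w c) :
    {x | CSol m W (fun c => (w c : ℂ)) x}.encard = (W.card).factorial := by
  rw [← encard_rsol hm hW hw]
  have : {x | CSol m W (fun c => (w c : ℂ)) x}
      = (fun (r : Fin (m - 3) → ℝ) (k : Fin (m - 3)) => (r k : ℂ)) '' {r | RSol m W w r} := by
    ext x
    constructor
    · intro h
      have hx : (fun k => (((x k).re : ℝ) : ℂ)) = x := by
        ext k
        apply Complex.ext
        · simp
        · simp [csol_im hm hw h k]
      refine ⟨fun k => (x k).re, ?_, hx⟩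
      apply (csol_iff hm _).mp
      rw [hx]
      exact h
    · rintro ⟨r, hr, rfl⟩
      exact (csol_iff hm _).mpr hr
  rw [this, Function.Injective.encard_image]
  intro a b h
  ext k
  exact Complex.ofReal_injective (congrFun h k)

/-- The defining polynomials of the solution set with reciprocals adjoined. -/
def polys (m : ℕ) (W : Finset ℕ) :
    Set (MvPolynomial (ColIdx m ⊕ (ColIdx m ⊕ Fin (m - 3))) ℂ) :=
  {f | (∃ c ∈ Iflat m W, f = MvPolynomial.X (Sum.inr (Sum.inl c)) *
        (MvPolynomial.C (Lm m 0 c) + ∑ j : Fin (m - 3),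
          MvPolynomial.X (Sum.inr (Sum.inr j)) * MvPolynomial.C (Lm m j.succ c)) - 1) ∨
    (∃ c, c ∉ Iflat m W ∧ f = MvPolynomial.X (Sum.inr (Sum.inl c))) ∨
    (∃ k : Fin (m - 3), (k : ℕ) + 1 ∉ W ∧ f = MvPolynomial.X (Sum.inr (Sum.inr k))) ∨
    (∃ k : Fin (m - 3), f = ∑ i : ColIdx m, MvPolynomial.C (Lm m k.succ i) *
        MvPolynomial.X (Sum.inl i) * MvPolynomial.X (Sum.inr (Sum.inl i)))}

theorem polys_zero {m : ℕ} {W : Finset ℕ} (s : ColIdx m → ℂ) :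
    {p : ColIdx m ⊕ Fin (m - 3) → ℂ | ∀ f ∈ polys m W, MvPolynomial.eval (Sum.elim s p) f = 0}
      = (fun x => Sum.elim (uvec m W x) x) '' {x | CSol m W s x} := by
  ext p
  constructor
  · intro h
    have h : ∀ f ∈ polys m W, MvPolynomial.eval (Sum.elim s p) f = 0 := h
    have h1 : ∀ c ∈ Iflat m W, p (Sum.inl c) * ell ℂ (Lm m) (fun k => p (Sum.inr k)) c = 1 := by
      intro c hc
      have := h _ (Or.inl ⟨c, hc, rfl⟩)
      simp only [map_sub, map_mul, map_add, map_sum, MvPolynomial.eval_X, MvPolynomial.eval_C,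
        Sum.elim_inr, map_one] at this
      exact sub_eq_zero.mp this
    have h2 : ∀ c, c ∉ Iflat m W → p (Sum.inl c) = 0 := by
      intro c hc
      simpa using h _ (Or.inr (Or.inl ⟨c, hc, rfl⟩))
    have h3 : ∀ k : Fin (m - 3), (k : ℕ) + 1 ∉ W → p (Sum.inr k) = 0 := by
      intro k hk
      simpa using h _ (Or.inr (Or.inr (Or.inl ⟨k, hk, rfl⟩)))
    have h4 : ∀ k : Fin (m - 3), ∑ i : ColIdx m, Lm m k.succ i * s i * p (Sum.inl i) = 0 := by
      intro k
      simpa using h _ (Or.inr (Or.inr (Or.inr ⟨k, rfl⟩)))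
    have hu : uvec m W (fun k => p (Sum.inr k)) = fun c => p (Sum.inl c) := by
      ext c
      by_cases hc : c ∈ Iflat m W
      · rw [uvec_of_mem hc]
        exact (eq_inv_of_mul_eq_one_left (h1 c hc)).symm
      · rw [uvec_of_not_mem hc, h2 c hc]
    refine ⟨fun k => p (Sum.inr k), ⟨h3, fun c hc => right_ne_zero_of_mul_eq_one (h1 c hc), ?_⟩, ?_⟩
    · rw [hu]
      exact h4
    · beta_reduce
      rw [hu]
      ext (c | k) <;> rfl
  · rintro ⟨x, hx, rfl⟩ f hf
    have hx : CSol m W s x := hx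
    rcases hf with ⟨c, hc, rfl⟩ | ⟨c, hc, rfl⟩ | ⟨k, hk, rfl⟩ | ⟨k, rfl⟩
    · simp only [map_sub, map_mul, map_add, map_sum, MvPolynomial.eval_X, MvPolynomial.eval_C,
        Sum.elim_inr, Sum.elim_inl, map_one, uvec_of_mem hc]
      exact sub_eq_zero.mpr (inv_mul_cancel₀ (hx.ne c hc))
    · simp [uvec_of_not_mem hc]
    · simp [hx.off k hk]
    · simpa using hx.eq k

theorem generic_csol {m : ℕ} {W : Finset ℕ} (hm : 4 ≤ m) (hW : W ⊆ Finset.Icc 1 (m - 3)) :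
    Generically (fun s : ColIdx m → ℂ => {x | CSol m W s x}.encard = (W.card).factorial) := by
  have key : ∀ s : ColIdx m → ℂ, {p : ColIdx m ⊕ Fin (m - 3) → ℂ |
      ∀ f ∈ polys m W, MvPolynomial.eval (Sum.elim s p) f = 0}.encard
        = {x | CSol m W s x}.encard := by
    intro s
    rw [polys_zero, Function.Injective.encard_image]
    intro x y h
    ext k
    simpa using congrFun h (Sum.inr k)
  have := generic_card (polys m W) ((W.card).factorial)
    {s : ColIdx m → ℂ | ∃ w : ColIdx m → ℝ, (∀ c, 0 < w c) ∧ s = fun c => (w c : ℂ)} ?_ ?_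
  · simpa only [key] using this
  · intro h hh
    by_contra hcon
    push Not at hcon
    apply hh
    apply MvPolynomial.funext_set (fun _ : ColIdx m => (fun t : ℝ => (t : ℂ)) '' Set.Ioi 0)
    · intro i
      exact (Set.Ioi_infinite 0).image Complex.ofReal_injective.injOn
    · intro s hs
      have hs : ∀ i, ∃ t : ℝ, 0 < t ∧ (t : ℂ) = s i := fun i => hs i (Set.mem_univ i)
      choose w hw1 hw2 using hs
      rw [map_zero]
      exact hcon s ⟨w, hw1, by ext i; exact (hw2 i).symm⟩
  · rintro s ⟨w, hw, rfl⟩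
    rw [key]
    exact encard_csol hm hW hw

theorem Generically.and' {σ : Type} [Fintype σ] [DecidableEq σ] {P Q : (σ → ℂ) → Prop}
    (hP : Generically P) (hQ : Generically Q) : Generically (fun u => P u ∧ Q u) := by
  obtain ⟨g, hg, h⟩ := hP
  obtain ⟨g', hg', h'⟩ := hQ
  refine ⟨g * g', mul_ne_zero hg hg', fun u hu => ?_⟩
  rw [map_mul] at hu
  exact ⟨h u (left_ne_zero_of_mul hu), h' u (right_ne_zero_of_mul hu)⟩

theorem Generically.all' {σ α : Type} [Fintype σ] [DecidableEq σ] (S : Finset α)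
    {P : α → (σ → ℂ) → Prop} (hP : ∀ a ∈ S, Generically (P a)) :
    Generically (fun u => ∀ a ∈ S, P a u) := by
  choose! g hg h using hP
  refine ⟨∏ a ∈ S, g a, Finset.prod_ne_zero_iff.mpr hg, fun u hu a ha => h a ha u ?_⟩
  rw [map_prod, Finset.prod_ne_zero_iff] at hu
  exact hu a ha

theorem generic_sums {σ : Type} [Fintype σ] [DecidableEq σ] :
    Generically (fun s : σ → ℂ => ∀ J : Finset σ, J.Nonempty → ∑ c ∈ J, s c ≠ 0) := by
  have := Generically.all' (σ := σ) (Finset.univ.filter fun J : Finset σ => J.Nonempty)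
    (P := fun J s => ∑ c ∈ J, s c ≠ 0) ?_
  · obtain ⟨g, hg, h⟩ := this
    exact ⟨g, hg, fun u hu J hJ => h u hu J (by simpa using hJ)⟩
  · intro J hJ
    have hJ : J.Nonempty := by simpa using hJ
    refine ⟨∑ c ∈ J, MvPolynomial.X c, ?_, fun u hu => by simpa using hu⟩
    intro h0
    have := congrArg (MvPolynomial.eval (fun _ : σ => (1 : ℂ))) h0
    simp at this
    exact hJ.ne_empty this



theorem uvec_smul_inj {m : ℕ} {W : Finset ℕ} (hm : 4 ≤ m) {s : ColIdx m → ℂ}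
    {x x' : Fin (m - 3) → ℂ} (hx : CSol m W s x) (hx' : CSol m W s x') {τ τ' : ℂ}
    (hτ : τ ≠ 0) (h : τ • uvec m W x = τ' • uvec m W x') : x = x' := by
  ext k
  by_cases hk : (k : ℕ) + 1 ∈ W
  swap
  · rw [hx.off k hk, hx'.off k hk]
  have m0 := col0_mem (m := m) (W := W) ⟨k, hk⟩
  have m1 := col1_mem (m := m) (W := W) ⟨k, hk⟩
  have e0 : ∀ y : Fin (m - 3) → ℂ,
      ell ℂ (Lm m) y (col 0 ((k : ℕ) + 2) (by have := k.2; omega)) = y k := by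
    intro y
    rw [ell_Lm hm]
    simp [col]
  have e1 : ∀ y : Fin (m - 3) → ℂ,
      ell ℂ (Lm m) y (col 1 ((k : ℕ) + 2) (by have := k.2; omega)) = y k - 1 := by
    intro y
    rw [ell_Lm hm]
    simp [col]
  have a0 := congrFun h (col 0 ((k : ℕ) + 2) (by have := k.2; omega))
  have a1 := congrFun h (col 1 ((k : ℕ) + 2) (by have := k.2; omega))
  simp only [Pi.smul_apply, smul_eq_mul] at a0 a1
  rw [uvec_of_mem m0, uvec_of_mem m0] at a0
  rw [uvec_of_mem m1, uvec_of_mem m1] at a1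
  have n0 := hx.ne _ m0
  have n0' := hx'.ne _ m0
  have n1 := hx.ne _ m1
  have n1' := hx'.ne _ m1
  simp only [e0] at a0 n0 n0'
  simp only [e1] at a1 n1 n1'
  rw [← div_eq_mul_inv, ← div_eq_mul_inv, div_eq_div_iff n0 n0'] at a0
  rw [← div_eq_mul_inv, ← div_eq_mul_inv, div_eq_div_iff n1 n1'] at a1
  have ht : τ = τ' := by linear_combination a0 - a1
  subst ht
  exact (mul_left_cancel₀ hτ a0).symm

theorem Iflat_inj {m : ℕ} {W W' : Finset ℕ} (hW : W ⊆ Finset.Icc 1 (m - 3))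
    (h : Iflat m W = Iflat m W') : W ⊆ W' := by
  intro i hi
  have h1 := Finset.mem_Icc.mp (hW hi)
  have h2 : col (m := m) 0 (i + 1) (by omega) ∈ Iflat m W := ⟨⟨i, hi, rfl⟩, Or.inl rfl⟩
  rw [h] at h2
  obtain ⟨⟨j, hj, e⟩, -⟩ := h2
  have : i + 1 = j + 1 := e
  have : i = j := by omega
  rwa [this]

section final
variable {m : ℕ} {s : ColIdx m → ℂ}

theorem uvec_ne_zero_iff {W : Finset ℕ} {x : Fin (m - 3) → ℂ} (hx : CSol m W s x) (c : ColIdx m) :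
    uvec m W x c ≠ 0 ↔ c ∈ Iflat m W := by
  by_cases hc : c ∈ Iflat m W
  · simp [hc, uvec_of_mem hc, hx.ne c hc]
  · simp [hc, uvec_of_not_mem hc]

theorem point_structure (hm : 4 ≤ m)
    (hs : ∀ J : Finset (ColIdx m), J.Nonempty → ∑ c ∈ J, s c ≠ 0) {p : Pn (ColIdx m)}
    (hp : p ∈ LuSet (Lm m) s ∩ RL (Lm m)) :
    ∃ W ⊆ Finset.Icc 1 (m - 3), W.Nonempty ∧ ∃ (x : Fin (m - 3) → ℂ) (τ : ℂ), CSol m W s x ∧ τ ≠ 0 ∧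
      p.rep = τ • uvec m W x := by
  obtain ⟨h1, h2⟩ := hp
  have h1 : ∀ k : Fin (m - 3), ∑ i, Lm m k.succ i * s i * p.rep i = 0 := h1
  obtain ⟨W, hW, hne, hsupp, x, τ, hτ, hoff, hx⟩ := structure_thm hm (tri_of_closure hm h2)
    p.rep_nonzero hs (fun V h0 h0' => contraction hm s p.rep h1 V h0 h0')
  have hrep : p.rep = τ • uvec m W x := by
    ext c
    by_cases hc : c ∈ Iflat m W
    · rw [(hx c hc).2, Pi.smul_apply, uvec_of_mem hc, smul_eq_mul, div_eq_mul_inv]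
    · rw [Pi.smul_apply, uvec_of_not_mem hc, smul_zero]
      by_contra h
      exact hc ((hsupp c).mp h)
  refine ⟨W, hW, hne, x, τ, ⟨hoff, fun c hc => (hx c hc).1, fun k => ?_⟩, hτ, hrep⟩
  have := h1 k
  rw [hrep] at this
  have h3 : τ * ∑ i, Lm m k.succ i * s i * uvec m W x i = 0 := by
    rw [← this, Finset.mul_sum]
    apply Finset.sum_congr rfl
    intro c _
    simp only [Pi.smul_apply, smul_eq_mul]
    ring
  exact (mul_eq_zero.mp h3).resolve_left hτ

theorem mem_comp_of {W : Finset ℕ} {x : Fin (m - 3) → ℂ} {τ : ℂ} {p : Pn (ColIdx m)}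
    (hx : CSol m W s x) (hτ : τ ≠ 0) (hp : p.rep = τ • uvec m W x) :
    p ∈ LuSet (Lm m) s ∩ RLsubOpen (Lm m) (Iflat m W) := by
  refine ⟨fun k => ?_, ?_, fun c => ?_⟩
  · rw [hp]
    calc _ = τ * ∑ i, Lm m k.succ i * s i * uvec m W x i := by
          rw [Finset.mul_sum]
          apply Finset.sum_congr rfl
          intro c _
          simp only [Pi.smul_apply, smul_eq_mul]
          ring
      _ = 0 := by rw [hx.eq k, mul_zero]
  · apply subset_zarClosure
    refine ⟨τ, x, fun c hc => hx.ne c hc, ?_⟩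
    rw [hp]
    ext c
    by_cases hc : c ∈ Iflat m W
    · simp [uvec_of_mem hc, hc, div_eq_mul_inv]
    · simp [uvec_of_not_mem hc, hc]
  · rw [hp, Pi.smul_apply, smul_eq_mul, ← uvec_ne_zero_iff hx c]
    simp [hτ]

theorem comp_subset (hm : 4 ≤ m) (W : Finset ℕ) :
    LuSet (Lm m) s ∩ RLsubOpen (Lm m) (Iflat m W) ⊆ LuSet (Lm m) s ∩ RL (Lm m) := by
  rintro p ⟨h1, h2, -⟩
  exact ⟨h1, zarClosure_minimal (coneImageSub_subset hm W) h2⟩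

theorem comp_structure (hm : 4 ≤ m)
    (hs : ∀ J : Finset (ColIdx m), J.Nonempty → ∑ c ∈ J, s c ≠ 0) {W : Finset ℕ}
    (hW : W ⊆ Finset.Icc 1 (m - 3)) {p : Pn (ColIdx m)}
    (hp : p ∈ LuSet (Lm m) s ∩ RLsubOpen (Lm m) (Iflat m W)) :
    ∃ x, CSol m W s x ∧ ∃ τ : ℂ, τ ≠ 0 ∧ p.rep = τ • uvec m W x := by
  obtain ⟨W', hW', -, x, τ, hx, hτ, hrep⟩ := point_structure hm hs (comp_subset hm W hp)
  have h1 := (mem_comp_of hx hτ hrep).2.2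
  have h2 := hp.2.2
  have he : Iflat m W = Iflat m W' := by
    ext c
    rw [← h1 c, ← h2 c]
  have : W = W' := Finset.Subset.antisymm (Iflat_inj hW he) (Iflat_inj hW' he.symm)
  subst this
  exact ⟨x, hx, τ, hτ, hrep⟩

theorem encard_comp (hm : 4 ≤ m)
    (hs : ∀ J : Finset (ColIdx m), J.Nonempty → ∑ c ∈ J, s c ≠ 0) {W : Finset ℕ}
    (hW : W ⊆ Finset.Icc 1 (m - 3)) (hne : W.Nonempty) :
    (LuSet (Lm m) s ∩ RLsubOpen (Lm m) (Iflat m W)).encard = {x | CSol m W s x}.encard := by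
  have hst := fun p (hp : p ∈ LuSet (Lm m) s ∩ RLsubOpen (Lm m) (Iflat m W)) =>
    comp_structure hm hs hW hp
  choose! X hX T hT hr using hst
  have hinj : Set.InjOn X (LuSet (Lm m) s ∩ RLsubOpen (Lm m) (Iflat m W)) := by
    intro p hp q hq h
    rw [← p.mk_rep, ← q.mk_rep, Projectivization.mk_eq_mk_iff']
    refine ⟨T p * (T q)⁻¹, ?_⟩
    rw [hr p hp, hr q hq, h, smul_smul, mul_assoc, inv_mul_cancel₀ (hT q hq), mul_one]
  rw [← hinj.encard_image]
  congr 1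
  ext x
  constructor
  · rintro ⟨p, hp, rfl⟩
    exact hX p hp
  · intro hx
    have hx : CSol m W s x := hx
    have hu : uvec m W x ≠ 0 := by
      obtain ⟨i, hi⟩ := hne
      have h1 := Finset.mem_Icc.mp (hW hi)
      have h2 : col (m := m) 0 (i + 1) (by omega) ∈ Iflat m W := ⟨⟨i, hi, rfl⟩, Or.inl rfl⟩
      intro h0
      exact (uvec_ne_zero_iff hx _).mpr h2 (by rw [h0]; rfl)
    obtain ⟨a, ha⟩ := Projectivization.exists_smul_eq_mk_rep ℂ (uvec m W x) hu
    have ha' : (Projectivization.mk ℂ (uvec m W x) hu).rep = (a : ℂ) • uvec m W x := ha.symm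
    have hp := mem_comp_of hx a.ne_zero ha'
    refine ⟨_, hp, ?_⟩
    apply uvec_smul_inj hm (hX _ hp) hx (hT _ hp) (τ' := (a : ℂ))
    rw [← hr _ hp, ha']

end final

/-- Theorem 5.6, assuming Conjecture 5.4.  If each point of
`𝕃_s ∩ ℛ^∘_{(L_m)_{I_r(W)}}` has intersection multiplicity `r!` in `𝕃_s ∩ ℛ_{L_m}`, then for
generic Mandelstam invariants `s` the set `𝕃_s ∩ ℛ_{L_m}` is finite and is the disjoint
union over `r = 0, …, m-4` and `W ∈ C({1,…,m-3}, m-3-r)` of the sets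
`𝕃_s ∩ ℛ^∘_{(L_m)_{I_r(W)}}`; the component `(r,W)` consists of `(m-3-r)!` points of
multiplicity `r!`, whose nonzero coordinates solve the CHY scattering equations for the
particles indexed by `1, 2, m` and `W`. -/
theorem M0m_intersection_decomposition (m : ℕ) (hm : 4 ≤ m)
    (hconj : Generically (fun s : ColIdx m → ℂ =>
      ∀ r ≤ m - 4, ∀ W : Finset ℕ, (↑W : Set ℕ) ⊆ Set.Icc 1 (m-3) → W.card = m-3-r →
        ∀ p ∈ LuSet (Lm m) s ∩ RLsubOpen (Lm m) (Iflat m W),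
          multAt (schemeIdeal m s) p = Nat.factorial r)) :
    Generically (fun s : ColIdx m → ℂ =>
      (LuSet (Lm m) s ∩ RL (Lm m)).Finite ∧
      (LuSet (Lm m) s ∩ RL (Lm m)
        = ⋃ r ∈ Set.Iic (m-4), ⋃ W ∈ {W : Finset ℕ |
            (↑W : Set ℕ) ⊆ Set.Icc 1 (m-3) ∧ W.card = m-3-r},
            LuSet (Lm m) s ∩ RLsubOpen (Lm m) (Iflat m W)) ∧
      (∀ r ≤ m - 4, ∀ r' ≤ m - 4, ∀ W W' : Finset ℕ,
        (↑W : Set ℕ) ⊆ Set.Icc 1 (m-3) → W.card = m-3-r →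
        (↑W' : Set ℕ) ⊆ Set.Icc 1 (m-3) → W'.card = m-3-r' → (r, W) ≠ (r', W') →
        Disjoint (LuSet (Lm m) s ∩ RLsubOpen (Lm m) (Iflat m W))
          (LuSet (Lm m) s ∩ RLsubOpen (Lm m) (Iflat m W'))) ∧
      (∀ r ≤ m - 4, ∀ W : Finset ℕ, (↑W : Set ℕ) ⊆ Set.Icc 1 (m-3) → W.card = m-3-r →
        (LuSet (Lm m) s ∩ RLsubOpen (Lm m) (Iflat m W)).ncard = Nat.factorial (m-3-r) ∧
        ∀ p ∈ LuSet (Lm m) s ∩ RLsubOpen (Lm m) (Iflat m W),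
          multAt (schemeIdeal m s) p = Nat.factorial r ∧
          ∃ x : Fin (m-3) → ℂ, (∀ i ∈ Iflat m W, ell ℂ (Lm m) x i ≠ 0) ∧
            (∃ c : ℂ, c ≠ 0 ∧ ∀ i ∈ Iflat m W, p.rep i = c / ell ℂ (Lm m) x i) ∧
            (∀ k : Fin (m-3), ∑ i : ColIdx m,
              (Iflat m W).indicator
                (fun i => s i * Lm m k.succ i / ell ℂ (Lm m) x i) i = 0))) := by
  have hcount := Generically.all' (σ := ColIdx m) (Finset.Icc 1 (m - 3)).powerset
    (P := fun W s => {x | CSol m W s x}.encard = (W.card).factorial)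
    (fun W hW => generic_csol hm (Finset.mem_powerset.mp hW))
  obtain ⟨g, hg, H⟩ := (hconj.and' generic_sums).and' hcount
  refine ⟨g, hg, fun s hs0 => ?_⟩
  obtain ⟨⟨hmult, hs⟩, hcnt⟩ := H s hs0
  have conv : ∀ W : Finset ℕ, (↑W : Set ℕ) ⊆ Set.Icc 1 (m-3) ↔ W ⊆ Finset.Icc 1 (m - 3) := by
    intro W
    rw [← Finset.coe_Icc, Finset.coe_subset]
  have henc : ∀ W : Finset ℕ, W ⊆ Finset.Icc 1 (m - 3) → W.Nonempty →
      (LuSet (Lm m) s ∩ RLsubOpen (Lm m) (Iflat m W)).encard = (W.card).factorial := by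
    intro W hW hne
    rw [encard_comp hm hs hW hne]
    exact hcnt W (Finset.mem_powerset.mpr hW)
  have hunion : LuSet (Lm m) s ∩ RL (Lm m)
        = ⋃ r ∈ Set.Iic (m-4), ⋃ W ∈ {W : Finset ℕ |
            (↑W : Set ℕ) ⊆ Set.Icc 1 (m-3) ∧ W.card = m-3-r},
            LuSet (Lm m) s ∩ RLsubOpen (Lm m) (Iflat m W) := by
    apply Set.Subset.antisymm
    · intro p hp
      obtain ⟨W, hW, hne, x, τ, hx, hτ, hrep⟩ := point_structure hm hs hp
      have hcard := Finset.card_le_card hW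
      rw [Nat.card_Icc] at hcard
      have hpos := hne.card_pos
      refine Set.mem_biUnion (x := m - 3 - W.card) (Set.mem_Iic.mpr (by omega)) ?_
      exact Set.mem_biUnion (x := W) ⟨(conv W).mpr hW, by omega⟩ (mem_comp_of hx hτ hrep)
    · intro p hp
      simp only [Set.mem_iUnion] at hp
      obtain ⟨r, -, W, -, hp⟩ := hp
      exact comp_subset hm W hp
  refine ⟨?_, hunion, ?_, ?_⟩
  · have hfin : (⋃ W ∈ (Finset.Icc 1 (m - 3)).powerset.filter Finset.Nonempty,
        LuSet (Lm m) s ∩ RLsubOpen (Lm m) (Iflat m W)).Finite := by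
      apply Set.Finite.biUnion (Finset.finite_toSet _)
      intro W hW
      have hW := Finset.mem_filter.mp hW
      apply Set.finite_of_encard_eq_coe (henc W (Finset.mem_powerset.mp hW.1) hW.2)
    apply hfin.subset
    intro p hp
    obtain ⟨W, hW, hne, x, τ, hx, hτ, hrep⟩ := point_structure hm hs hp
    exact Set.mem_biUnion (x := W)
      (Finset.mem_filter.mpr ⟨Finset.mem_powerset.mpr hW, hne⟩) (mem_comp_of hx hτ hrep)
  · intro r hr r' hr' W W' hW hc hW' hc' hneq
    rw [Set.disjoint_left]
    intro p hp hp'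
    have he : Iflat m W = Iflat m W' := by
      ext c
      rw [← hp.2.2 c, ← hp'.2.2 c]
    have : W = W' := Finset.Subset.antisymm (Iflat_inj ((conv _).mp hW) he)
      (Iflat_inj ((conv _).mp hW') he.symm)
    subst this
    apply hneq
    have : r = r' := by omega
    rw [this]
  · intro r hr W hW hc
    have hne : W.Nonempty := by
      rw [← Finset.card_pos]
      omega
    refine ⟨?_, fun p hp => ⟨hmult r hr W hW hc p hp, ?_⟩⟩
    · rw [Set.ncard, henc W ((conv W).mp hW) hne, hc]
      rfl
    · obtain ⟨x, hx, τ, hτ, hrep⟩ := comp_structure hm hs ((conv W).mp hW) hp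
      refine ⟨x, hx.ne, ⟨τ, hτ, fun i hi => ?_⟩, fun k => ?_⟩
      · rw [hrep, Pi.smul_apply, uvec_of_mem hi, smul_eq_mul, div_eq_mul_inv]
      · rw [← hx.eq k]
        apply Finset.sum_congr rfl
        intro c _
        by_cases hc : c ∈ Iflat m W
        · rw [Set.indicator_of_mem hc, uvec_of_mem hc, div_eq_mul_inv]
          ring
        · rw [Set.indicator_of_notMem hc, uvec_of_not_mem hc, mul_zero]



end ScatteringPaper
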